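/- arXiv:2209.04885 — 5 statements merged into one kernel-verified Lean document; each statement's English description precedes it below -/
import Mathlib

section
/- Let F = (F₁,…,F_l) : ℝⁿ → ℝ^l, let Ω ⊆ ℝⁿ, let λ ∈ ℝ^l with λ_i > 0 for all i and Σ_i λ_i = 1, let p ∈ [1, ∞) be real (finite), and let y ∈ ℝ^l satisfy y_i < F_i(x) for all x ∈ Ω and all i. Then every x̂ ∈ S(λ, p, F, Ω), i.e. every minimizer over Ω of Σ_{i=1}^l (λ_i (F_i(x) − y_i))^p, is a properly Pareto solution of F on Ω: there exists M > 0 such that for every index i and every x ∈ Ω with F_i(x) < F_i(x̂) there exists an index i₀ with F_{i₀}(x̂) < F_{i₀}(x) and (F_i(x̂) − F_i(x)) / (F_{i₀}(x) − F_{i₀}(x̂)) ≤ M. -/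
/-- On `[a, a + b]` the convex function `u ↦ u ^ p` lies below its chord. -/
theorem Real.rpow_add_mul_le_of_one_le {p a b t : ℝ} (hp : 1 ≤ p) (ha : 0 ≤ a) (hb : 0 ≤ b)
    (ht : 0 ≤ t) (ht1 : t ≤ 1) :
    (a + b * t) ^ p ≤ a ^ p + t * ((a + b) ^ p - a ^ p) := by
  have h := (convexOn_rpow hp).2 (x := a) ha (y := a + b) (add_nonneg ha hb)
    (sub_nonneg.2 ht1) ht (by ring)
  simp only [smul_eq_mul] at h
  calc (a + b * t) ^ p = ((1 - t) * a + t * (a + b)) ^ p := by ring_nf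
    _ ≤ _ := h
    _ = _ := by ring

/-- On `[0, a]` the function `u ↦ u ^ p` lies below its chord. -/
theorem Real.rpow_le_rpow_sub_one_mul {p a u : ℝ} (hp : 1 ≤ p) (hu : 0 < u) (hua : u ≤ a) :
    u ^ p ≤ a ^ (p - 1) * u := by
  calc u ^ p = u ^ (p - 1) * u := by
        rw [Real.rpow_sub_one hu.ne', div_mul_cancel₀ _ hu.ne']
    _ ≤ _ := by gcongr

/-- Every minimizer over `Ω` of the utopia-point scalarization
`x ↦ Σ_i (λ_i (F_i(x) − y_i))^p` (with `λ_i > 0`, `Σ λ_i = 1`, `p ∈ [1,∞)` and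
utopia point `y` satisfying `y_i < F_i(x)` on `Ω`) is a properly Pareto solution
of `F` on `Ω`. -/
theorem scalarization_minimizer_is_properly_Pareto {n l : ℕ}
    (F : Fin l → (Fin n → ℝ) → ℝ) (Ω : Set (Fin n → ℝ))
    (lam : Fin l → ℝ) (hlam : ∀ i, 0 < lam i) (hsum : ∑ i, lam i = 1)
    (pp : ℝ) (hpp : 1 ≤ pp)
    (y : Fin l → ℝ) (hy : ∀ x ∈ Ω, ∀ i, y i < F i x)
    (xhat : Fin n → ℝ) (hxhat : xhat ∈ Ω)
    (hmin : ∀ x ∈ Ω,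
      (∑ i, (lam i * (F i xhat - y i)) ^ pp) ≤ ∑ i, (lam i * (F i x - y i)) ^ pp) :
    ∃ M > (0 : ℝ), ∀ i : Fin l, ∀ x ∈ Ω, F i x < F i xhat →
      ∃ i₀ : Fin l, F i₀ xhat < F i₀ x ∧
        (F i xhat - F i x) / (F i₀ x - F i₀ xhat) ≤ M := by
  set a : Fin l → ℝ := fun j => lam j * (F j xhat - y j) with ha
  have ha0 : ∀ j, 0 < a j := fun j => mul_pos (hlam j) (sub_pos.2 (hy xhat hxhat j))
  set C : Fin l → ℝ := fun j => (a j + lam j) ^ pp - a j ^ pp with hC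
  have hC0 : ∀ j, 0 ≤ C j := fun j => sub_nonneg.2 <|
    Real.rpow_le_rpow (ha0 j).le (by linarith [hlam j]) (by linarith)
  set c : Fin l → ℝ := fun j => a j ^ (pp - 1) * lam j with hc
  have hc0 : ∀ j, 0 < c j := fun j => mul_pos (Real.rpow_pos_of_pos (ha0 j) _) (hlam j)
  have hd0 : ∀ j, 0 < F j xhat - y j := fun j => sub_pos.2 (hy xhat hxhat j)
  have hS0 : 0 ≤ ∑ j, C j := Finset.sum_nonneg fun j _ => hC0 j
  have hterm : ∀ k, 0 ≤ (F k xhat - y k) + (∑ j, C j) / c k := fun k =>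
    add_nonneg (hd0 k).le (div_nonneg hS0 (hc0 k).le)
  set M : ℝ := 1 + ∑ k, ((F k xhat - y k) + (∑ j, C j) / c k) with hM
  have hM0 : 0 < M := add_pos_of_pos_of_nonneg one_pos (Finset.sum_nonneg fun k _ => hterm k)
  refine ⟨M, hM0, fun i x hx hix => ?_⟩
  by_contra! hcon
  have hMi : 1 + ((F i xhat - y i) + (∑ j, C j) / c i) ≤ M := by
    have := Finset.single_le_sum (fun k _ => hterm k) (Finset.mem_univ i)
    linarith
  set e := F i xhat - F i x with he
  have he0 : 0 < e := sub_pos.2 hix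
  have ht0 : 0 ≤ e / M := by positivity
  have ht1 : e / M ≤ 1 := by
    rw [div_le_one hM0]
    linarith [hy x hx i, div_nonneg hS0 (hc0 i).le]
  have hbound : ∀ j, F j x - F j xhat ≤ e / M := by
    intro j
    rcases le_or_gt (F j x) (F j xhat) with h | h
    · linarith
    · have h1 := hcon j h
      rw [lt_div_iff₀ (sub_pos.2 h)] at h1
      rw [le_div_iff₀ hM0]
      linarith
  have hle : ∀ j, (lam j * (F j x - y j)) ^ pp ≤
      a j ^ pp + e / M * C j - (if j = i then c i * e else 0) := by
    intro j
    have hu0 : 0 < lam j * (F j x - y j) := mul_pos (hlam j) (sub_pos.2 (hy x hx j))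
    split_ifs with hji
    · subst hji
      have h1 := Real.rpow_le_rpow_sub_one_mul hpp hu0
        (mul_le_mul_of_nonneg_left (sub_le_sub_right hix.le (y j)) (hlam j).le)
      have h2 : a j ^ pp = a j ^ (pp - 1) * a j := by
        rw [Real.rpow_sub_one (ha0 j).ne', div_mul_cancel₀ _ (ha0 j).ne']
      have h3 : a j ^ (pp - 1) * (lam j * (F j x - y j)) = a j ^ pp - c j * e := by
        rw [h2]
        simp only [hc, he, ha]
        ring
      have h4 := mul_nonneg ht0 (hC0 j)
      have h5 : (lam j * (F j x - y j)) ^ pp ≤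
        a j ^ (pp - 1) * (lam j * (F j x - y j)) := h1
      linarith
    · rw [sub_zero]
      refine le_trans (Real.rpow_le_rpow hu0.le ?_ (by linarith))
        (Real.rpow_add_mul_le_of_one_le hpp (ha0 j).le (hlam j).le ht0 ht1)
      have := mul_le_mul_of_nonneg_left (hbound j) (hlam j).le
      simp only [ha]
      linarith
  have hsumle := (hmin x hx).trans (Finset.sum_le_sum fun j _ => hle j)
  rw [Finset.sum_sub_distrib, Finset.sum_add_distrib, ← Finset.mul_sum,
    Finset.sum_ite_eq' Finset.univ i, if_pos (Finset.mem_univ i)] at hsumle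
  have hkey : c i * e ≤ e / M * ∑ j, C j := by
    have : ∑ j, (lam j * (F j xhat - y j)) ^ pp = ∑ j, a j ^ pp := rfl
    linarith
  have hlt : (∑ j, C j) < M * c i := by
    rw [← div_lt_iff₀ (hc0 i)]
    linarith [hd0 i]
  have : e / M * ∑ j, C j < e / M * (M * c i) :=
    mul_lt_mul_of_pos_left hlt (div_pos he0 hM0)
  have h6 : e / M * (M * c i) = c i * e := by
    field_simp
  linarith
end

section
/- Let X ⊆ ℝⁿ be compact and let φ be a finite Borel measure with φ(O) > 0 for every nonempty open set O ⊆ ℝⁿ with O ⊆ X. Let Ω ⊆ X be nonempty and compact with cl(int(Ω)) = Ω. For i = 1,…,l let F_i : ℝⁿ → ℝ be continuous, and for each t ∈ ℕ let F_i^t : ℝⁿ → ℝ be continuous with F_i^t(x) ≥ F_i(x) for all x ∈ X and ∫_X |F_i^t − F_i| dφ → 0 as t → ∞. Let λ ∈ ℝ^l with λ_i > 0 for all i, let p ∈ [1, ∞) be real, and let y ∈ ℝ^l satisfy y_i < F_i(x) for all x ∈ X and all i. Define Γ(x) = Σ_{i=1}^l (λ_i (F_i(x) − y_i))^p and Γ^t(x)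 = Σ_{i=1}^l (λ_i (F_i^t(x) − y_i))^p. Then liminf_{t → ∞} ( min_{x ∈ Ω} Γ^t(x) ) = min_{x ∈ Ω} Γ(x). -/
open MeasureTheory Filter

/-- A point of small value exists in any set of positive measure once the integrals tend to `0`. -/
theorem eventually_exists_lt_of_tendsto_setIntegral {α : Type*} [MeasurableSpace α]
    {μ : Measure α} [IsFiniteMeasure μ] {X U : Set α}
    (hU : MeasurableSet U) (hUX : U ⊆ X) (hpos : 0 < μ U) {h : ℕ → α → ℝ}
    (hnonneg : ∀ t x, 0 ≤ h t x) (hint : ∀ t, IntegrableOn (h t) X μ)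
    (hlim : Tendsto (fun t => ∫ x in X, h t x ∂μ) atTop (nhds 0)) {δ : ℝ} (hδ : 0 < δ) :
    ∀ᶠ t in atTop, ∃ x ∈ U, h t x < δ := by
  have hreal : 0 < μ.real U := ENNReal.toReal_pos hpos.ne' (measure_ne_top μ U)
  filter_upwards [hlim.eventually_lt_const (mul_pos hδ hreal)] with t ht
  by_contra! hcon
  have h1 : δ * μ.real U ≤ ∫ x in U, h t x ∂μ :=
    setIntegral_ge_of_const_le_real hU (measure_ne_top μ U) hcon ((hint t).mono_set hUX)
  have h2 : ∫ x in U, h t x ∂μ ≤ ∫ x in X, h t x ∂μ :=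
    setIntegral_mono_set (hint t) (ae_of_all _ (hnonneg t)) hUX.eventuallyLE
  linarith

/-- (Convergence of optimal values, Theorem 4.4 of the paper.)
With `Ω ⊆ X` nonempty compact satisfying `cl(int Ω) = Ω`, continuous upper
approximations `F_i^t ≥ F_i` converging to `F_i` in `L¹(X, φ)` for a strictly
positive finite Borel measure `φ`, positive weights `λ`, `p ∈ [1, ∞)`, and a
utopia point `y` with `y_i < F_i(x)` on `X`, one has
`liminf_t min_{x ∈ Ω} Γ^t(x) = min_{x ∈ Ω} Γ(x)`. -/
theorem liminf_approx_scalarization_min_eq_min {n l : ℕ}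
    (X : Set (Fin n → ℝ)) (hX : IsCompact X)
    (φ : Measure (Fin n → ℝ)) [IsFiniteMeasure φ]
    (hφpos : ∀ O : Set (Fin n → ℝ), IsOpen O → O.Nonempty → O ⊆ X → 0 < φ O)
    (Ω : Set (Fin n → ℝ)) (hΩne : Ω.Nonempty) (hΩc : IsCompact Ω) (hΩX : Ω ⊆ X)
    (hH2 : closure (interior Ω) = Ω)
    (F : Fin l → (Fin n → ℝ) → ℝ) (hF : ∀ i, Continuous (F i))
    (Ft : ℕ → Fin l → (Fin n → ℝ) → ℝ) (hFt : ∀ t i, Continuous (Ft t i))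
    (hge : ∀ t i, ∀ x ∈ X, F i x ≤ Ft t i x)
    (hL1 : ∀ i, Tendsto (fun t => ∫ x in X, |Ft t i x - F i x| ∂φ) atTop (nhds 0))
    (lam : Fin l → ℝ) (hlam : ∀ i, 0 < lam i)
    (pp : ℝ) (hpp : 1 ≤ pp)
    (y : Fin l → ℝ) (hy : ∀ x ∈ X, ∀ i, y i < F i x) :
    Filter.liminf
        (fun t => sInf ((fun x => ∑ i, (lam i * (Ft t i x - y i)) ^ pp) '' Ω)) atTop
      = sInf ((fun x => ∑ i, (lam i * (F i x - y i)) ^ pp) '' Ω) := by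
  set g : (Fin l → ℝ) → ℝ := fun v => ∑ i, (lam i * (v i - y i)) ^ pp
  have hpp0 : 0 ≤ pp := zero_le_one.trans hpp
  have hg : Continuous g := by
    refine continuous_finsetSum _ fun i _ => Continuous.rpow_const ?_ fun _ => Or.inr hpp0
    fun_prop
  have hgF : Continuous fun x => g fun i => F i x := by fun_prop
  have hgFt : ∀ t, Continuous fun x => g fun i => Ft t i x := fun t => by fun_prop
  change liminf (fun t => sInf ((fun x => g fun i => Ft t i x) '' Ω)) atTop
    = sInf ((fun x => g fun i => F i x) '' Ω)
  refine Tendsto.liminf_eq (tendsto_order.2 ⟨fun a ha => ?_, fun a ha => ?_⟩)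
  · refine Eventually.of_forall fun t => ha.trans_le ?_
    refine le_csInf (hΩne.image _) ?_
    rintro _ ⟨x, hx, rfl⟩
    refine (csInf_le (hΩc.image hgF).bddBelow (Set.mem_image_of_mem _ hx)).trans ?_
    refine Finset.sum_le_sum fun i _ => ?_
    have hyi := hy x (hΩX hx) i
    exact Real.rpow_le_rpow (mul_nonneg (hlam i).le (by linarith))
      (mul_le_mul_of_nonneg_left (by linarith [hge t i x (hΩX hx)]) (hlam i).le) hpp0
  · obtain ⟨_, ⟨x₀, hx₀, rfl⟩, hx₀a⟩ := exists_lt_of_csInf_lt (hΩne.image _) ha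
    rw [← hH2] at hx₀
    obtain ⟨x₁, hx₁a, hx₁⟩ :=
      mem_closure_iff.1 hx₀ _ (isOpen_lt hgF continuous_const) hx₀a
    have hG : Continuous fun q : (Fin n → ℝ) × (Fin l → ℝ) => g fun i => F i q.1 + q.2 i := by
      fun_prop
    have hnear : ∀ᶠ q in nhds x₁ ×ˢ nhds (0 : Fin l → ℝ), (g fun i => F i q.1 + q.2 i) < a := by
      rw [← nhds_prod_eq]
      exact hG.continuousAt.eventually_lt_const (by simpa using hx₁a)
    obtain ⟨V, hV, W, hW, hVW⟩ := mem_prod_iff.1 hnear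
    obtain ⟨δ, hδ, hδW⟩ := Metric.mem_nhds_iff.1 hW
    set U := interior V ∩ interior Ω
    have hUopen : IsOpen U := isOpen_interior.inter isOpen_interior
    have hUΩ : U ⊆ Ω := Set.inter_subset_right.trans interior_subset
    have hUne : U.Nonempty := ⟨x₁, mem_interior_iff_mem_nhds.2 hV, hx₁⟩
    have hint : ∀ t i, IntegrableOn (fun x => |Ft t i x - F i x|) X φ := fun t i =>
      ((hFt t i).sub (hF i)).abs.continuousOn.integrableOn_compact hX
    have hlim : Tendsto (fun t => ∫ x in X, ∑ i, |Ft t i x - F i x| ∂φ) atTop (nhds 0) := by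
      simp_rw [integral_finsetSum _ fun i _ => hint _ i]
      simpa using tendsto_finsetSum Finset.univ fun i _ => hL1 i
    filter_upwards [eventually_exists_lt_of_tendsto_setIntegral
      hUopen.measurableSet (hUΩ.trans hΩX) (hφpos U hUopen hUne (hUΩ.trans hΩX))
      (fun t x => Finset.sum_nonneg fun i _ => abs_nonneg _)
      (fun t => integrable_finsetSum _ fun i _ => hint t i) hlim hδ] with t ⟨x, hxU, hx⟩
    refine (csInf_le (hΩc.image (hgFt t)).bddBelow
      (Set.mem_image_of_mem _ (hUΩ hxU))).trans_lt ?_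
    have hmem : (fun i => Ft t i x - F i x) ∈ W := by
      refine hδW (mem_ball_zero_iff.2 ((pi_norm_lt_iff hδ).2 fun i => lt_of_le_of_lt ?_ hx))
      exact Finset.single_le_sum (f := fun i => |Ft t i x - F i x|)
        (fun i _ => abs_nonneg _) (Finset.mem_univ i)
    simpa using hVW (Set.mk_mem_prod (interior_subset hxU.1) hmem)
end

section
/- Let Ω ⊆ ℝⁿ be nonempty and compact, let Γ : ℝⁿ → ℝ be continuous, and for each k ∈ ℕ let Γ_k : ℝⁿ → ℝ be continuous with Γ_k(x) ≥ Γ(x) for all x ∈ Ω. Assume min_{x ∈ Ω} Γ_k(x) → min_{x ∈ Ω} Γ(x) as k → ∞. Let S_k = argmin_{x ∈ Ω} Γ_k(x). Then the set ⋂_{r=1}^∞ cl( ⋃_{k=r}^∞ S_k ) is nonempty and is contained in argmin_{x ∈ Ω} Γ(x). -/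
open Filter

/-- The upper limit of a sequence of nonempty subsets of a compact set is nonempty. -/
theorem nonempty_iInter_closure_iUnion_of_isCompact {X : Type*} [TopologicalSpace X] [T2Space X]
    {K : Set X} (hK : IsCompact K) {S : ℕ → Set X} (hSK : ∀ k, S k ⊆ K)
    (hS : ∀ k, (S k).Nonempty) :
    (⋂ r : ℕ, closure (⋃ k : ℕ, ⋃ _ : r ≤ k, S k)).Nonempty := by
  have hsub : ∀ r : ℕ, closure (⋃ k : ℕ, ⋃ _ : r ≤ k, S k) ⊆ K := fun r =>
    closure_minimal (Set.iUnion₂_subset fun k _ => hSK k) hK.isClosed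
  refine IsCompact.nonempty_iInter_of_sequence_nonempty_isCompact_isClosed _
    (fun r => closure_mono (Set.iUnion₂_subset fun k hk => ?_)) (fun r => ?_)
    (hK.of_isClosed_subset isClosed_closure (hsub 0)) (fun r => isClosed_closure)
  · exact Set.subset_iUnion₂ (s := fun k (_ : r ≤ k) => S k) k (by omega)
  · obtain ⟨x, hx⟩ := hS r
    exact ⟨x, subset_closure (Set.mem_iUnion₂.2 ⟨r, le_rfl, hx⟩)⟩

/-- If `f ≤ F k` on the closed set `K` and the infima of `F k` over `K` converge to that of `f`,
then every accumulation point of minimizers of `F k` attains at most the infimum of `f`. -/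
theorem iInter_closure_iUnion_minimizers_subset {X : Type*} [TopologicalSpace X]
    {K : Set X} (hK : IsClosed K) {f : X → ℝ} (hf : Continuous f) {F : ℕ → X → ℝ}
    (hle : ∀ k, ∀ x ∈ K, f x ≤ F k x)
    (hlim : Tendsto (fun k => sInf (F k '' K)) atTop (nhds (sInf (f '' K)))) :
    (⋂ r : ℕ, closure (⋃ k : ℕ, ⋃ _ : r ≤ k, {x ∈ K | ∀ z ∈ K, F k x ≤ F k z})) ⊆
      {x ∈ K | f x ≤ sInf (f '' K)} := by
  intro x hx
  have key : ∀ c, sInf (f '' K) < c → x ∈ K ∩ {y | f y ≤ c} := by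
    intro c hc
    obtain ⟨r, hr⟩ := eventually_atTop.1 (hlim.eventually_lt_const hc)
    refine closure_minimal (Set.iUnion₂_subset fun k hk y hy => ?_)
      (hK.inter (isClosed_le hf continuous_const)) (Set.mem_iInter.1 hx r)
    refine ⟨hy.1, (hle k y hy.1).trans (le_trans ?_ (hr k hk).le)⟩
    exact le_csInf ⟨_, y, hy.1, rfl⟩ (Set.forall_mem_image.2 hy.2)
  exact ⟨(key _ (lt_add_one _)).1, le_of_forall_gt_imp_ge_of_dense fun c hc => (key c hc).2⟩

/-- (Theorem 4.5 of the paper.) If `Γ_k ≥ Γ` on the nonempty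
compact set `Ω`, all functions are continuous, and `min_Ω Γ_k → min_Ω Γ`, then
the set of accumulation points `⋂_r cl(⋃_{k ≥ r} argmin_Ω Γ_k)` is nonempty and
contained in `argmin_Ω Γ`. -/
theorem accumulation_points_of_approx_argmin {n : ℕ}
    (Ω : Set (Fin n → ℝ)) (hΩne : Ω.Nonempty) (hΩc : IsCompact Ω)
    (Γ : (Fin n → ℝ) → ℝ) (hΓ : Continuous Γ)
    (Γk : ℕ → (Fin n → ℝ) → ℝ) (hΓk : ∀ k, Continuous (Γk k))
    (hge : ∀ k, ∀ x ∈ Ω, Γ x ≤ Γk k x)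
    (hconv : Tendsto (fun k => sInf (Γk k '' Ω)) atTop (nhds (sInf (Γ '' Ω)))) :
    (⋂ r : ℕ, closure (⋃ k : ℕ, ⋃ _ : r ≤ k,
        {x ∈ Ω | ∀ z ∈ Ω, Γk k x ≤ Γk k z})).Nonempty ∧
    (⋂ r : ℕ, closure (⋃ k : ℕ, ⋃ _ : r ≤ k,
        {x ∈ Ω | ∀ z ∈ Ω, Γk k x ≤ Γk k z})) ⊆ {x ∈ Ω | ∀ z ∈ Ω, Γ x ≤ Γ z} := by
  refine ⟨nonempty_iInter_closure_iUnion_of_isCompact hΩc (fun k => Set.sep_subset _ _) fun k => ?_,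
    fun x hx => ?_⟩
  · obtain ⟨x, hx, hmin⟩ := hΩc.exists_isMinOn hΩne (hΓk k).continuousOn
    exact ⟨x, hx, fun z hz => hmin hz⟩
  · obtain ⟨hxΩ, hxle⟩ := iInter_closure_iUnion_minimizers_subset hΩc.isClosed hΓ hge hconv hx
    exact ⟨hxΩ, fun z hz => hxle.trans
      (csInf_le (hΩc.bddBelow_image hΓ.continuousOn) (Set.mem_image_of_mem Γ hz))⟩
end

section
/- Let l ≥ 1, let F = (F₁,…,F_l) : ℝⁿ → ℝ^l, let Ω ⊆ ℝⁿ be nonempty, and let y ∈ ℝ^l satisfy y_i < F_i(x) for all x ∈ Ω and all i. Then a point x̂ ∈ Ω is a weak Pareto solution of F on Ω if and only if there exists λ ∈ ℝ^l with λ_i > 0 for all i and Σ_i λ_i = 1 such that x̂ minimizes the weighted Chebyshev scalarization x ↦ max_{1 ≤ i ≤ l} λ_i (F_i(x) − y_i) over Ω. -/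
/-- (Chebyshev scalarization characterizes weak Pareto
solutions.) For `l ≥ 1`, a nonempty `Ω` and a utopia point `y` (`y_i < F_i(x)`
on `Ω`), a point `xhat ∈ Ω` is a weak Pareto solution of `F` on `Ω` iff there
are weights `λ_i > 0` with `Σ λ_i = 1` such that `xhat` minimizes
`x ↦ max_i λ_i (F_i(x) − y_i)` over `Ω`. -/
theorem weak_Pareto_iff_Chebyshev_minimizer {n l : ℕ} (hl : 1 ≤ l)
    (F : Fin l → (Fin n → ℝ) → ℝ) (Ω : Set (Fin n → ℝ)) (hΩne : Ω.Nonempty)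
    (y : Fin l → ℝ) (hy : ∀ x ∈ Ω, ∀ i, y i < F i x)
    (xhat : Fin n → ℝ) (hxhat : xhat ∈ Ω) :
    (¬ ∃ x ∈ Ω, ∀ i : Fin l, F i x < F i xhat) ↔
    ∃ lam : Fin l → ℝ, (∀ i, 0 < lam i) ∧ (∑ i, lam i = 1) ∧
      ∀ x ∈ Ω, (⨆ i : Fin l, lam i * (F i xhat - y i))
        ≤ ⨆ i : Fin l, lam i * (F i x - y i) := by
  have : Nonempty (Fin l) := ⟨⟨0, hl⟩⟩
  constructor
  · intro hP
    have hpos : ∀ i, 0 < F i xhat - y i := fun i => sub_pos.2 (hy xhat hxhat i)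
    have hS : 0 < ∑ i, (F i xhat - y i)⁻¹ :=
      Finset.sum_pos (fun i _ => inv_pos.2 (hpos i)) Finset.univ_nonempty
    have hlam : ∀ i, 0 < (F i xhat - y i)⁻¹ / ∑ j, (F j xhat - y j)⁻¹ :=
      fun i => div_pos (inv_pos.2 (hpos i)) hS
    refine ⟨fun i => (F i xhat - y i)⁻¹ / ∑ j, (F j xhat - y j)⁻¹, hlam, ?_, fun x hx => ?_⟩
    · rw [← Finset.sum_div, div_self hS.ne']
    · push Not at hP
      obtain ⟨j, hj⟩ := hP x hx
      refine ciSup_le fun i => ?_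
      calc (F i xhat - y i)⁻¹ / (∑ k, (F k xhat - y k)⁻¹) * (F i xhat - y i)
          = (F j xhat - y j)⁻¹ / (∑ k, (F k xhat - y k)⁻¹) * (F j xhat - y j) := by
            rw [div_mul_eq_mul_div, div_mul_eq_mul_div, inv_mul_cancel₀ (hpos i).ne',
              inv_mul_cancel₀ (hpos j).ne']
        _ ≤ (F j xhat - y j)⁻¹ / (∑ k, (F k xhat - y k)⁻¹) * (F j x - y j) :=
            mul_le_mul_of_nonneg_left (sub_le_sub_right hj _) (hlam j).le
        _ ≤ _ := le_ciSup (f := fun i =>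
            (F i xhat - y i)⁻¹ / (∑ k, (F k xhat - y k)⁻¹) * (F i x - y i))
            (Set.finite_range _).bddAbove j
  · rintro ⟨lam, hlam, -, hmin⟩ ⟨x, hx, hlt⟩
    obtain ⟨j, hj⟩ := exists_eq_ciSup_of_finite (f := fun i => lam i * (F i x - y i))
    have hsup := le_ciSup (f := fun i => lam i * (F i xhat - y i))
      (Set.finite_range _).bddAbove j
    have hstrict := mul_lt_mul_of_pos_left (sub_lt_sub_right (hlt j) (y j)) (hlam j)
    exact absurd (hmin x hx) (not_le.2 (hj ▸ hstrict.trans_le hsup))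
end

section
/- (Putinar's Positivstellensatz) Let f, g₁,…,g_m be real polynomials in n variables, let K = {x ∈ ℝⁿ : g_j(x) ≥ 0, j = 1,…,m} be nonempty, and suppose the quadratic module Q(g) = { σ₀ + Σ_{j=1}^m σ_j g_j : σ_j sums of squares of polynomials } is Archimedean, i.e., there exists p ∈ Q(g) such that {x ∈ ℝⁿ : p(x) ≥ 0} is compact. If f(x) > 0 for all x ∈ K, then f ∈ Q(g), i.e., there exist polynomials σ₀,…,σ_m, each a sum of squares, with f = σ₀ + Σ_{j=1}^m σ_j g_j. -/
open MvPolynomial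

/-- A real multivariate polynomial is a sum of squares. -/
def IsSumOfSquares {n : ℕ} (q : MvPolynomial (Fin n) ℝ) : Prop :=
  ∃ (r : ℕ) (h : Fin r → MvPolynomial (Fin n) ℝ), q = ∑ k, (h k) ^ 2

/-- Membership in the quadratic module generated by `g₁, …, g_m`:
`f = σ₀ + Σ_j σ_j g_j` with all `σ_j` sums of squares. -/
def MemQuadraticModule {n m : ℕ} (g : Fin m → MvPolynomial (Fin n) ℝ)
    (f : MvPolynomial (Fin n) ℝ) : Prop :=
  ∃ (σ₀ : MvPolynomial (Fin n) ℝ) (σ : Fin m → MvPolynomial (Fin n) ℝ),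
    IsSumOfSquares σ₀ ∧ (∀ j, IsSumOfSquares (σ j)) ∧
    f = σ₀ + ∑ j, σ j * g j

/-- The intermediate value property for polynomials over an ordered field. -/
def PolynomialIVT (R : Type*) [Field R] [LinearOrder R] : Prop :=
  ∀ (p : Polynomial R) (a b : R), a < b → p.eval a < 0 → 0 < p.eval b →
    ∃ c, a < c ∧ c < b ∧ p.eval c = 0

section OrderedField

variable {R : Type*} [Field R] [LinearOrder R] [IsStrictOrderedRing R]

theorem PolynomialIVT.exists_root_of_mul_neg (hR : PolynomialIVT R) (p : Polynomial R) {a b : R}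
    (hab : a < b) (h : p.eval a * p.eval b < 0) : ∃ c, a < c ∧ c < b ∧ p.eval c = 0 := by
  rcases mul_neg_iff.1 h with ⟨h1, h2⟩ | ⟨h1, h2⟩
  · obtain ⟨c, h3, h4, h5⟩ := hR (-p) a b hab (by simpa using h1) (by simpa using h2)
    exact ⟨c, h3, h4, by simpa using h5⟩
  · exact hR p a b hab h1 h2

theorem PolynomialIVT.sign_eq (hR : PolynomialIVT R) (p : Polynomial R) {a b : R}
    (hab : a ≤ b) (h : ∀ c, a ≤ c → c ≤ b → p.eval c ≠ 0) :
    SignType.sign (p.eval a) = SignType.sign (p.eval b) := by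
  rcases hab.eq_or_lt with rfl | hab
  · rfl
  have ha := h a le_rfl hab.le
  have hb := h b hab.le le_rfl
  by_contra hne
  have : p.eval a * p.eval b < 0 := by
    rcases ha.lt_or_gt with h1 | h1 <;> rcases hb.lt_or_gt with h2 | h2
    · simp [h1, h2] at hne
    · exact mul_neg_of_neg_of_pos h1 h2
    · exact mul_neg_of_pos_of_neg h1 h2
    · simp [h1, h2] at hne
  obtain ⟨c, h1, h2, h3⟩ := hR.exists_root_of_mul_neg p hab this
  exact h c h1.le h2.le h3

theorem Polynomial.exists_eq_pow_succ_mul {K : Type*} [Field K] {f : Polynomial K} (hf : f ≠ 0)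
    {a : K} (ha : f.eval a = 0) :
    ∃ (m : ℕ) (g : Polynomial K), f = (X - C a) ^ (m + 1) * g ∧ g.eval a ≠ 0 := by
  obtain ⟨g, hg, hd⟩ := f.exists_eq_pow_rootMultiplicity_mul_and_not_dvd hf a
  have : 0 < f.rootMultiplicity a := (Polynomial.rootMultiplicity_pos hf).2 ha
  refine ⟨f.rootMultiplicity a - 1, g, ?_, ?_⟩
  · rwa [Nat.sub_add_cancel this]
  · intro h
    exact hd (Polynomial.dvd_iff_isRoot.2 h)

theorem PolynomialIVT.rolle (hR : PolynomialIVT R) {f : Polynomial R} (hf : f ≠ 0) {a b : R}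
    (hab : a < b) (ha : f.eval a = 0) (hb : f.eval b = 0) :
    ∃ c, a < c ∧ c < b ∧ f.derivative.eval c = 0 := by
  wlog hcons : ∀ c, a < c → c < b → f.eval c ≠ 0 generalizing b
  · have hne : (f.roots.toFinset.filter (fun c => a < c)).Nonempty :=
      ⟨b, by simp [hf, hab, hb]⟩
    set b' := Finset.min' _ hne with hb'
    have hmem := Finset.min'_mem _ hne
    rw [← hb'] at hmem
    simp only [Finset.mem_filter, Multiset.mem_toFinset, Polynomial.mem_roots hf,
      Polynomial.IsRoot] at hmem
    have hle : b' ≤ b := Finset.min'_le _ _ (by simp [hf, hab, hb])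
    obtain ⟨c, h1, h2, h3⟩ := this hmem.2 hmem.1 (fun c hac hcb h0 =>
      absurd (Finset.min'_le (f.roots.toFinset.filter (fun c => a < c)) c
        (by simp [hf, hac, h0])) (not_le.2 hcb))
    exact ⟨c, h1, h2.trans_le hle, h3⟩
  obtain ⟨m, g₁, hg₁, hg₁a⟩ := Polynomial.exists_eq_pow_succ_mul hf ha
  have hg₁0 : g₁ ≠ 0 := by rintro rfl; simp at hg₁a
  have hg₁b : g₁.eval b = 0 := by
    rw [hg₁] at hb
    simpa [sub_ne_zero.2 hab.ne'] using hb
  obtain ⟨k, g, hg, hgb⟩ := Polynomial.exists_eq_pow_succ_mul hg₁0 hg₁b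
  have hga : g.eval a ≠ 0 := by
    intro h; rw [hg] at hg₁a; simp [h] at hg₁a
  have hsign := hR.sign_eq g hab.le (by
    intro c hac hcb h0
    rcases hac.eq_or_lt with rfl | hac
    · exact hga h0
    rcases hcb.eq_or_lt with rfl | hcb
    · exact hgb h0
    exact hcons c hac hcb (by rw [hg₁, hg]; simp [h0]))
  have hpos : 0 < g.eval a * g.eval b := by
    rcases hga.lt_or_gt with h1 | h1 <;> rcases hgb.lt_or_gt with h2 | h2
    · exact mul_pos_of_neg_of_neg h1 h2
    · simp [h1, h2] at hsign
    · simp [h1, h2] at hsign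
    · exact mul_pos h1 h2
  let q : Polynomial R := ((m + 1 : R) • (.X - .C b) + (k + 1 : R) • (.X - .C a)) * g +
    (.X - .C a) * (.X - .C b) * g.derivative
  obtain ⟨c, h1, h2, h3⟩ := hR.exists_root_of_mul_neg q hab (by
    have e : q.eval a * q.eval b = -((m + 1) * (k + 1) * (b - a) ^ 2 * (g.eval a * g.eval b)) := by
      simp [q]; ring
    rw [e, neg_lt_zero]
    have : 0 < b - a := sub_pos.2 hab
    positivity)
  refine ⟨c, h1, h2, ?_⟩
  have e : f.derivative.eval c = (c - a) ^ m * (c - b) ^ k * q.eval c := by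
    rw [hg₁, hg]
    simp [q, Polynomial.derivative_pow]
    ring
  rw [e, h3, mul_zero]

theorem PolynomialIVT.mean_value (hR : PolynomialIVT R) (f : Polynomial R) {a b : R}
    (hab : a < b) :
    ∃ c, a < c ∧ c < b ∧ f.derivative.eval c * (b - a) = f.eval b - f.eval a := by
  let F : Polynomial R := .C (b - a) * f - .C (f.eval b - f.eval a) * .X
    - .C ((b - a) * f.eval a - (f.eval b - f.eval a) * a)
  have hd : ∀ c, F.derivative.eval c = f.derivative.eval c * (b - a) - (f.eval b - f.eval a) := by
    intro c; simp [F]; ring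
  suffices ∃ c, a < c ∧ c < b ∧ F.derivative.eval c = 0 by
    obtain ⟨c, h1, h2, h3⟩ := this
    exact ⟨c, h1, h2, by rw [hd] at h3; linarith⟩
  by_cases hF : F = 0
  · obtain ⟨c, h1, h2⟩ := exists_between hab
    exact ⟨c, h1, h2, by simp [hF]⟩
  · exact hR.rolle hF hab (by simp [F]) (by simp [F]; ring)

theorem Polynomial.exists_forall_le_eval_of_leadingCoeff_pos (f : Polynomial R)
    (hf : 0 < f.leadingCoeff) : ∃ ε B : R, 0 < ε ∧ ∀ x, B ≤ x → ε ≤ f.eval x := by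
  induction hd : f.natDegree generalizing f with
  | zero =>
    refine ⟨f.leadingCoeff, 0, hf, fun x _ => ?_⟩
    rw [Polynomial.eq_C_of_natDegree_eq_zero hd]
    simp
  | succ d ih =>
    have hdeg : f.divX.natDegree = d := by
      rw [Polynomial.natDegree_divX_eq_natDegree_tsub_one, hd]; rfl
    have hlc : f.divX.leadingCoeff = f.leadingCoeff := by
      rw [Polynomial.leadingCoeff, Polynomial.leadingCoeff, hdeg, hd, Polynomial.coeff_divX]
    obtain ⟨ε, B, hε, hB⟩ := ih f.divX (hlc ▸ hf) hdeg
    refine ⟨ε, max B (1 + |f.coeff 0| / ε), hε, fun x hx => ?_⟩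
    have h1 := hB x ((le_max_left _ _).trans hx)
    have h2 : 1 + |f.coeff 0| / ε ≤ x := (le_max_right _ _).trans hx
    have h0 : 0 ≤ x := le_trans (by positivity) h2
    have h3 : (1 + |f.coeff 0| / ε) * ε ≤ x * ε := mul_le_mul_of_nonneg_right h2 hε.le
    have h4 : (1 + |f.coeff 0| / ε) * ε = ε + |f.coeff 0| := by field_simp
    have h5 : x * ε ≤ x * f.divX.eval x := mul_le_mul_of_nonneg_left h1 h0
    have h6 := neg_abs_le (f.coeff 0)
    have h7 : f.eval x = f.divX.eval x * x + f.coeff 0 := by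
      conv_lhs => rw [← Polynomial.divX_mul_X_add f]
      simp
    rw [h7]; nlinarith

theorem Polynomial.exists_forall_sign_eval_eq (f : Polynomial R) :
    ∃ B : R, ∀ x, B ≤ x → SignType.sign (f.eval x) = SignType.sign f.leadingCoeff := by
  rcases lt_trichotomy f.leadingCoeff 0 with h | h | h
  · obtain ⟨ε, B, hε, hB⟩ := (-f).exists_forall_le_eval_of_leadingCoeff_pos (by simpa using h)
    refine ⟨B, fun x hx => ?_⟩
    have := hB x hx
    rw [sign_neg h, sign_neg]
    simp at this; linarith
  · rw [Polynomial.leadingCoeff_eq_zero] at h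
    exact ⟨0, by simp [h]⟩
  · obtain ⟨ε, B, hε, hB⟩ := f.exists_forall_le_eval_of_leadingCoeff_pos h
    refine ⟨B, fun x hx => ?_⟩
    rw [sign_pos h, sign_pos (hε.trans_le (hB x hx))]

theorem Polynomial.exists_forall_sign_eval_neg_eq (f : Polynomial R) :
    ∃ B : R, ∀ x, x ≤ -B →
      SignType.sign (f.eval x) = (-1) ^ f.natDegree * SignType.sign f.leadingCoeff := by
  obtain ⟨B, hB⟩ := (f.comp (-Polynomial.X)).exists_forall_sign_eval_eq
  refine ⟨B, fun x hx => ?_⟩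
  have := hB (-x) (le_neg.2 hx)
  rw [Polynomial.leadingCoeff_comp (by simp)] at this
  simp only [Polynomial.eval_comp, Polynomial.eval_neg, Polynomial.eval_X, neg_neg] at this
  rw [this, sign_mul, sign_pow, mul_comm]
  simp

end OrderedField

section PseudoDivision

variable {A : Type*} [CommRing A]

theorem Polynomial.exists_pow_mul_eq_mul_add (f : Polynomial A) (hf : 0 < f.natDegree)
    (h : Polynomial A) : ∃ (k : ℕ) (q r : Polynomial A),
      C (f.leadingCoeff ^ k) * h = q * f + r ∧ r.natDegree < f.natDegree := by
  induction hn : h.natDegree using Nat.strong_induction_on generalizing h with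
  | _ n ih =>
    by_cases hlt : h.natDegree < f.natDegree
    · exact ⟨0, 0, h, by simp, hlt⟩
    rw [not_lt] at hlt
    set h' := C f.leadingCoeff * h - C h.leadingCoeff * X ^ (h.natDegree - f.natDegree) * f with hh'
    have hdeg : h'.natDegree ≤ h.natDegree := by
      refine (natDegree_sub_le _ _).trans (max_le (natDegree_C_mul_le _ _) ?_)
      refine natDegree_mul_le.trans ?_
      have := natDegree_C_mul_X_pow_le h.leadingCoeff (h.natDegree - f.natDegree)
      omega
    have hcoeff : h'.coeff h.natDegree = 0 := by
      obtain ⟨m, hm⟩ := Nat.exists_eq_add_of_le hlt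
      rw [hh', coeff_sub, coeff_C_mul, mul_assoc, coeff_C_mul, mul_comm (X ^ _) f,
        show h.natDegree - f.natDegree = m by omega]
      simp only [leadingCoeff]
      rw [hm, Nat.add_comm f.natDegree m, coeff_mul_X_pow', if_pos (Nat.le_add_right _ _)]
      simp only [Nat.add_sub_cancel_left]
      ring
    have hlt' : h'.natDegree < n := by
      have := natDegree_le_pred hdeg hcoeff
      omega
    obtain ⟨k, q, r, h1, h2⟩ := ih _ hlt' h' rfl
    refine ⟨k + 1, q + C (f.leadingCoeff ^ k) * (C h.leadingCoeff *
      X ^ (h.natDegree - f.natDegree)), r, ?_, h2⟩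
    have : C f.leadingCoeff * h = h' + C h.leadingCoeff * X ^ (h.natDegree - f.natDegree) * f := by
      rw [hh']; ring
    rw [pow_succ, C_mul, mul_assoc, this, mul_add, h1]
    ring

theorem Polynomial.exists_even_pow_mul_eq_mul_add (f h : Polynomial A) :
    ∃ r : Polynomial A, 0 < f.natDegree → r.natDegree < f.natDegree ∧
      ∃ (k : ℕ) (q : Polynomial A), C (f.leadingCoeff ^ (2 * k)) * h = q * f + r := by
  by_cases hf : 0 < f.natDegree
  · obtain ⟨k, q, r, h1, h2⟩ := f.exists_pow_mul_eq_mul_add hf h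
    refine ⟨C (f.leadingCoeff ^ k) * r, fun _ => ⟨(natDegree_C_mul_le _ _).trans_lt h2, k,
      C (f.leadingCoeff ^ k) * q, ?_⟩⟩
    rw [two_mul, pow_add, C_mul, mul_assoc, h1]
    ring
  · exact ⟨0, fun h => absurd h hf⟩

/-- A pseudo-remainder of `h` by `f`, scaled by an even power of the leading coefficient. -/
noncomputable def Polynomial.evenPseudoRem (f h : Polynomial A) : Polynomial A :=
  (f.exists_even_pow_mul_eq_mul_add h).choose

theorem Polynomial.evenPseudoRem_spec {f : Polynomial A} (hf : 0 < f.natDegree)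
    (h : Polynomial A) : (f.evenPseudoRem h).natDegree < f.natDegree ∧
      ∃ (k : ℕ) (q : Polynomial A),
        C (f.leadingCoeff ^ (2 * k)) * h = q * f + f.evenPseudoRem h :=
  (f.exists_even_pow_mul_eq_mul_add h).choose_spec hf

/-- The closure of a set of polynomials under the operations that occur in the sign analysis
of Cohen and Hörmander. -/
inductive HormanderClosure (S : Set (Polynomial A)) : Polynomial A → Prop
  | base {f} : f ∈ S → HormanderClosure S f
  | lc {f} : HormanderClosure S f → 0 < f.natDegree →
      HormanderClosure S (Polynomial.C f.leadingCoeff)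
  | eraseLead {f} : HormanderClosure S f → 0 < f.natDegree → HormanderClosure S f.eraseLead
  | derivative {f} : HormanderClosure S f → 0 < f.natDegree →
      HormanderClosure S (Polynomial.derivative f)
  | rem {f h} : HormanderClosure S f → HormanderClosure S h → 0 < f.natDegree →
      f.natDegree ≤ h.natDegree → HormanderClosure S (f.evenPseudoRem h)

theorem Polynomial.natDegree_eraseLead_lt_of_pos {f : Polynomial A} (hf : 0 < f.natDegree) :
    f.eraseLead.natDegree < f.natDegree := by
  rcases f.eraseLead_natDegree_lt_or_eraseLead_eq_zero with h | h
  · exact h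
  · simpa [h] using hf

theorem HormanderClosure.finite {S : Set (Polynomial A)} (hS : S.Finite) :
    {f | HormanderClosure S f}.Finite := by
  obtain ⟨D, hD⟩ : ∃ D, ∀ f ∈ S, f.natDegree < D := by
    obtain ⟨D, hD⟩ := (hS.image Polynomial.natDegree).bddAbove
    exact ⟨D + 1, fun f hf => Nat.lt_succ_of_le (hD ⟨f, hf, rfl⟩)⟩
  have hbound : ∀ f, HormanderClosure S f → f.natDegree < D := by
    intro f hf
    induction hf with
    | base h => exact hD _ h
    | lc h hd ih => simpa using hd.trans ih
    | eraseLead h hd ih => exact (Polynomial.natDegree_eraseLead_lt_of_pos hd).trans ih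
    | derivative h hd ih => exact (Polynomial.natDegree_derivative_lt hd.ne').trans ih
    | rem h1 h2 hd hle ih1 ih2 => exact (Polynomial.evenPseudoRem_spec hd _).1.trans ih1
  have key : ∀ k, {f | HormanderClosure S f ∧ D ≤ f.natDegree + k}.Finite := by
    intro k
    induction k with
    | zero =>
      convert Set.finite_empty (α := Polynomial A)
      ext f
      simp only [Set.mem_ofPred_eq, Set.mem_empty_iff_false, iff_false, not_and, add_zero, not_le]
      exact hbound f
    | succ k ih =>
      set W := {f | HormanderClosure S f ∧ D ≤ f.natDegree + k}
      refine ((((((hS.union (ih.image fun f => Polynomial.C f.leadingCoeff)).union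
        (ih.image Polynomial.eraseLead)).union
        (ih.image Polynomial.derivative)).union
        ((ih.prod ih).image fun p => p.1.evenPseudoRem p.2)))).subset ?_
      rintro f ⟨hf, hk⟩
      cases hf with
      | base h => simp [h]
      | @lc g h hd =>
        have : g ∈ W := ⟨h, by simp at hk; omega⟩
        exact Or.inl (Or.inl (Or.inl (Or.inr ⟨g, this, rfl⟩)))
      | @eraseLead g h hd =>
        have := Polynomial.natDegree_eraseLead_lt_of_pos hd
        exact Or.inl (Or.inl (Or.inr ⟨g, ⟨h, by omega⟩, rfl⟩))
      | @derivative g h hd =>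
        have := Polynomial.natDegree_derivative_lt hd.ne'
        exact Or.inl (Or.inr ⟨g, ⟨h, by omega⟩, rfl⟩)
      | @rem g h h1 h2 hd hle =>
        have := (Polynomial.evenPseudoRem_spec hd h).1
        exact Or.inr ⟨(g, h), ⟨⟨h1, by change D ≤ g.natDegree + k; omega⟩,
          ⟨h2, by change D ≤ h.natDegree + k; omega⟩⟩, rfl⟩
  exact (key D).subset fun f hf => ⟨hf, by omega⟩

end PseudoDivision

section SignTransfer

set_option linter.unusedSectionVars false

theorem eq_zero_iff_of_sign_eq {α β : Type*} [Zero α] [LinearOrder α] [Zero β] [LinearOrder β]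
    {a : α} {b : β} (h : SignType.sign a = SignType.sign b) : a = 0 ↔ b = 0 := by
  rw [← sign_eq_zero_iff, h, sign_eq_zero_iff]

theorem mul_neg_of_sign_eq {R₁ R₂ : Type*} [Field R₁] [LinearOrder R₁] [IsStrictOrderedRing R₁]
    [Field R₂] [LinearOrder R₂] [IsStrictOrderedRing R₂] {a b : R₁} {a' b' : R₂}
    (ha : SignType.sign a = SignType.sign a') (hb : SignType.sign b = SignType.sign b')
    (h : a * b < 0) : a' * b' < 0 := by
  rw [← sign_eq_neg_one_iff, sign_mul] at h ⊢
  rwa [← ha, ← hb]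

/-- Two points have the same position relative to a finite set of pairs of points. -/
def SamePosition {α β : Type*} [LinearOrder α] [LinearOrder β] (L : Finset (α × β))
    (x : α) (y : β) : Prop :=
  ∀ p ∈ L, (x < p.1 ↔ y < p.2) ∧ (p.1 < x ↔ p.2 < y)

theorem SamePosition.swap {α β : Type*} [LinearOrder α] [LinearOrder β] {L : Finset (α × β)}
    {x : α} {y : β} (h : SamePosition L x y) : SamePosition (L.image Prod.swap) y x := by
  intro p hp
  obtain ⟨q, hq, rfl⟩ := Finset.mem_image.1 hp
  exact ⟨(h q hq).1.symm, (h q hq).2.symm⟩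

theorem SamePosition.of_swap {α β : Type*} [LinearOrder α] [LinearOrder β] {L : Finset (α × β)}
    {x : α} {y : β} (h : SamePosition (L.image Prod.swap) y x) : SamePosition L x y := by
  have := h.swap
  simpa [Finset.image_image] using this

theorem exists_neighbors {α β : Type*} [LinearOrder α] (L : Finset (α × β)) (x : α)
    (hx : ∀ p ∈ L, p.1 ≠ x) (hlo : ∃ p ∈ L, p.1 < x) (hhi : ∃ p ∈ L, x < p.1) :
    ∃ p ∈ L, ∃ q ∈ L, p.1 < x ∧ x < q.1 ∧ ∀ r ∈ L, r.1 ≤ p.1 ∨ q.1 ≤ r.1 := by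
  obtain ⟨p, hp, hpm⟩ := (L.filter fun p => p.1 < x).exists_max_image Prod.fst
    (by obtain ⟨p, h⟩ := hlo; exact ⟨p, by simpa using h⟩)
  obtain ⟨q, hq, hqm⟩ := (L.filter fun p => x < p.1).exists_min_image Prod.fst
    (by obtain ⟨p, h⟩ := hhi; exact ⟨p, by simpa using h⟩)
  rw [Finset.mem_filter] at hp hq
  refine ⟨p, hp.1, q, hq.1, hp.2, hq.2, fun r hr => ?_⟩
  rcases (hx r hr).lt_or_gt with h | h
  · exact Or.inl (hpm r (Finset.mem_filter.2 ⟨hr, h⟩))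
  · exact Or.inr (hqm r (Finset.mem_filter.2 ⟨hr, h⟩))

variable {A : Type*} [CommRing A]

/-- A set of polynomials closed under the operations of `HormanderClosure`. -/
structure IsHormanderClosed (S : Set (Polynomial A)) : Prop where
  lc : ∀ f ∈ S, 0 < f.natDegree → Polynomial.C f.leadingCoeff ∈ S
  eraseLead : ∀ f ∈ S, 0 < f.natDegree → f.eraseLead ∈ S
  derivative : ∀ f ∈ S, 0 < f.natDegree → Polynomial.derivative f ∈ S
  rem : ∀ f ∈ S, ∀ h ∈ S, 0 < f.natDegree → f.natDegree ≤ h.natDegree → f.evenPseudoRem h ∈ S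

theorem HormanderClosure.isHormanderClosed (S : Set (Polynomial A)) :
    IsHormanderClosed {f | HormanderClosure S f} :=
  ⟨fun _ h => h.lc, fun _ h => h.eraseLead, fun _ h => h.derivative, fun _ h _ h' => h.rem h'⟩

variable {R₁ R₂ : Type*} [Field R₁] [LinearOrder R₁] [IsStrictOrderedRing R₁]
  [Field R₂] [LinearOrder R₂] [IsStrictOrderedRing R₂]

/-- `L` matches the roots of the polynomials in `s` over two ordered fields in such a way that
sign conditions are preserved. -/
structure RootMatching (φ₁ : A →+* R₁) (φ₂ : A →+* R₂) (S s : Set (Polynomial A))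
    (L : Finset (R₁ × R₂)) (B₁ : R₁) (B₂ : R₂) : Prop where
  mono : ∀ p ∈ L, ∀ q ∈ L, p.1 < q.1 ↔ p.2 < q.2
  top : (B₁, B₂) ∈ L
  bot : (-B₁, -B₂) ∈ L
  agree : ∀ p ∈ L, ∀ f ∈ S,
    SignType.sign ((f.map φ₁).eval p.1) = SignType.sign ((f.map φ₂).eval p.2)
  roots₁ : ∀ f ∈ s, f.map φ₁ ≠ 0 → ∀ x, (f.map φ₁).eval x = 0 → ∃ p ∈ L, p.1 = x
  roots₂ : ∀ f ∈ s, f.map φ₂ ≠ 0 → ∀ y, (f.map φ₂).eval y = 0 → ∃ p ∈ L, p.2 = y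
  sign_eq : ∀ x y, SamePosition L x y → ∀ f ∈ s,
    SignType.sign ((f.map φ₁).eval x) = SignType.sign ((f.map φ₂).eval y)
  bound₁ : ∀ f ∈ S, φ₁ f.leadingCoeff ≠ 0 → ∀ x, (f.map φ₁).eval x = 0 → -B₁ < x ∧ x < B₁
  bound₂ : ∀ f ∈ S, φ₂ f.leadingCoeff ≠ 0 → ∀ y, (f.map φ₂).eval y = 0 → -B₂ < y ∧ y < B₂

theorem RootMatching.swap {φ₁ : A →+* R₁} {φ₂ : A →+* R₂} {S s : Set (Polynomial A)}
    {L : Finset (R₁ × R₂)} {B₁ : R₁} {B₂ : R₂} (h : RootMatching φ₁ φ₂ S s L B₁ B₂) :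
    RootMatching φ₂ φ₁ S s (L.image Prod.swap) B₂ B₁ where
  mono p hp q hq := by
    obtain ⟨p, hp', rfl⟩ := Finset.mem_image.1 hp
    obtain ⟨q, hq', rfl⟩ := Finset.mem_image.1 hq
    exact (h.mono p hp' q hq').symm
  top := Finset.mem_image.2 ⟨_, h.top, rfl⟩
  bot := Finset.mem_image.2 ⟨_, h.bot, rfl⟩
  agree p hp f hf := by
    obtain ⟨p, hp', rfl⟩ := Finset.mem_image.1 hp
    exact (h.agree p hp' f hf).symm
  roots₁ f hf h0 x hx := by
    obtain ⟨p, hp, h⟩ := h.roots₂ f hf h0 x hx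
    exact ⟨p.swap, Finset.mem_image_of_mem _ hp, h⟩
  roots₂ f hf h0 x hx := by
    obtain ⟨p, hp, h⟩ := h.roots₁ f hf h0 x hx
    exact ⟨p.swap, Finset.mem_image_of_mem _ hp, h⟩
  sign_eq x y hxy f hf := (h.sign_eq y x hxy.of_swap f hf).symm
  bound₁ := h.bound₂
  bound₂ := h.bound₁

theorem Polynomial.map_derivative_ne_zero {φ : A →+* R₁} {f : Polynomial A} (hd : 0 < f.natDegree)
    (hlc : φ f.leadingCoeff ≠ 0) : f.derivative.map φ ≠ 0 := by
  rw [← Polynomial.derivative_map]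
  intro h
  have h1 := Polynomial.derivative_eq_zero.1 h
  rw [Polynomial.natDegree_map_of_leadingCoeff_ne_zero φ hlc] at h1
  omega

theorem Polynomial.map_ne_zero_of_leadingCoeff {φ : A →+* R₁} {f : Polynomial A}
    (hlc : φ f.leadingCoeff ≠ 0) : f.map φ ≠ 0 := by
  intro h
  apply hlc
  have := congrArg (fun p => p.coeff f.natDegree) h
  simpa using this

namespace RootMatching

variable {φ₁ : A →+* R₁} {φ₂ : A →+* R₂} {S s : Set (Polynomial A)} {L : Finset (R₁ × R₂)}
  {B₁ : R₁} {B₂ : R₂}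

theorem samePosition (H : RootMatching φ₁ φ₂ S s L B₁ B₂) {p : R₁ × R₂} (hp : p ∈ L) :
    SamePosition L p.1 p.2 := fun q hq => ⟨H.mono p hp q hq, H.mono q hq p hp⟩

/-- A nonconstant polynomial whose derivative is already matched has at most one root in each
gap of the matching. -/
theorem not_two_roots (hR : PolynomialIVT R₁) (H : RootMatching φ₁ φ₂ S s L B₁ B₂)
    {f : Polynomial A} (hd : 0 < f.natDegree) (hf' : f.derivative ∈ s)
    (hlc : φ₁ f.leadingCoeff ≠ 0) {a b : R₁} (hab : a < b)
    (hgap : ∀ p ∈ L, p.1 ≤ a ∨ b ≤ p.1)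
    (ha : (f.map φ₁).eval a = 0) (hb : (f.map φ₁).eval b = 0) : False := by
  obtain ⟨c, h1, h2, h3⟩ := hR.rolle (Polynomial.map_ne_zero_of_leadingCoeff hlc) hab ha hb
  rw [Polynomial.derivative_map] at h3
  obtain ⟨p, hp, rfl⟩ := H.roots₁ _ hf' (Polynomial.map_derivative_ne_zero hd hlc) c h3
  rcases hgap p hp with h | h
  · exact absurd h1 (not_lt.2 h)
  · exact absurd h2 (not_lt.2 h)

theorem exists_partner (hR₁ : PolynomialIVT R₁) (hR₂ : PolynomialIVT R₂)
    (H : RootMatching φ₁ φ₂ S s L B₁ B₂) {f : Polynomial A} (hfS : f ∈ S)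
    (hd : 0 < f.natDegree) (hf' : f.derivative ∈ s)
    (hlc : φ₁ f.leadingCoeff ≠ 0) {x : R₁} (hx : (f.map φ₁).eval x = 0) :
    ∃ y, (f.map φ₂).eval y = 0 ∧ SamePosition L x y := by
  by_cases hxL : ∃ p ∈ L, p.1 = x
  · obtain ⟨p, hp, rfl⟩ := hxL
    exact ⟨p.2, (eq_zero_iff_of_sign_eq (H.agree p hp f hfS)).1 hx, H.samePosition hp⟩
  push Not at hxL
  obtain ⟨hx1, hx2⟩ := H.bound₁ f hfS hlc x hx
  obtain ⟨p, hp, q, hq, hpx, hxq, hgap⟩ :=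
    exists_neighbors L x hxL ⟨_, H.bot, hx1⟩ ⟨_, H.top, hx2⟩
  have hp0 : (f.map φ₁).eval p.1 ≠ 0 := fun h0 =>
    H.not_two_roots hR₁ hd hf' hlc hpx (fun r hr => (hgap r hr).imp_right hxq.le.trans) h0 hx
  have hq0 : (f.map φ₁).eval q.1 ≠ 0 := fun h0 =>
    H.not_two_roots hR₁ hd hf' hlc hxq (fun r hr => (hgap r hr).imp_left fun h => h.trans hpx.le)
      hx h0
  have hneg : (f.map φ₁).eval p.1 * (f.map φ₁).eval q.1 < 0 := by
    obtain ⟨c, hc1, hc2, hc3⟩ := hR₁.mean_value (f.map φ₁) hpx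
    obtain ⟨d, hd1, hd2, hd3⟩ := hR₁.mean_value (f.map φ₁) hxq
    rw [Polynomial.derivative_map] at hc3 hd3
    have hcd : SignType.sign ((f.derivative.map φ₁).eval c) =
        SignType.sign ((f.derivative.map φ₁).eval d) := by
      refine hR₁.sign_eq _ (hc2.trans hd1).le fun e he1 he2 he0 => ?_
      obtain ⟨r, hr, rfl⟩ := H.roots₁ _ hf' (Polynomial.map_derivative_ne_zero hd hlc) e he0
      rcases hgap r hr with h | h
      · exact absurd (hc1.trans_le (he1.trans h)) (lt_irrefl _)
      · exact absurd (hd2.trans_le (h.trans he2)) (lt_irrefl _)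
    have e1 : SignType.sign ((f.map φ₁).eval q.1) = SignType.sign (-(f.map φ₁).eval p.1) := by
      rw [hx, zero_sub] at hc3
      rw [hx, sub_zero] at hd3
      rw [← hc3, ← hd3, sign_mul, sign_mul, hcd, sign_pos (sub_pos.2 hpx), sign_pos (sub_pos.2 hxq)]
    rcases hp0.lt_or_gt with h | h
    · rw [sign_pos (neg_pos.2 h), sign_eq_one_iff] at e1
      exact mul_neg_of_neg_of_pos h e1
    · rw [sign_neg (neg_lt_zero.2 h), sign_eq_neg_one_iff] at e1
      exact mul_neg_of_pos_of_neg h e1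
  obtain ⟨y, hy1, hy2, hy0⟩ := hR₂.exists_root_of_mul_neg (f.map φ₂)
    ((H.mono p hp q hq).1 (hpx.trans hxq))
    (mul_neg_of_sign_eq (H.agree p hp f hfS) (H.agree q hq f hfS) hneg)
  refine ⟨y, hy0, fun r hr => ?_⟩
  rcases hgap r hr with h | h
  · have h' : r.2 ≤ p.2 := not_lt.1 fun hlt => absurd ((H.mono p hp r hr).2 hlt) (not_lt.2 h)
    have h1 := h.trans_lt hpx
    have h2 := h'.trans_lt hy1
    exact ⟨iff_of_false h1.le.not_gt h2.le.not_gt, iff_of_true h1 h2⟩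
  · have h' : q.2 ≤ r.2 := not_lt.1 fun hlt => absurd ((H.mono r hr q hq).2 hlt) (not_lt.2 h)
    have h1 := hxq.trans_le h
    have h2 := hy2.trans_le h'
    exact ⟨iff_of_true h1 h2, iff_of_false h1.le.not_gt h2.le.not_gt⟩

theorem agree_of_roots (H : RootMatching φ₁ φ₂ S s L B₁ B₂) (hS : IsHormanderClosed S)
    {f : Polynomial A} (hfS : f ∈ S) (hd : 0 < f.natDegree)
    (hlow : ∀ h ∈ S, h.natDegree < f.natDegree → h ∈ s)
    (hlc₁ : φ₁ f.leadingCoeff ≠ 0) (hlc₂ : φ₂ f.leadingCoeff ≠ 0) {x : R₁} {y : R₂}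
    (hx : (f.map φ₁).eval x = 0) (hy : (f.map φ₂).eval y = 0) (hxy : SamePosition L x y)
    {h : Polynomial A} (hh : h ∈ S) :
    SignType.sign ((h.map φ₁).eval x) = SignType.sign ((h.map φ₂).eval y) := by
  rcases lt_or_ge h.natDegree f.natDegree with hlt | hge
  · exact H.sign_eq x y hxy h (hlow h hh hlt)
  obtain ⟨hr, k, q, hq⟩ := Polynomial.evenPseudoRem_spec hd h
  have key := H.sign_eq x y hxy _ (hlow _ (hS.rem f hfS h hh hd hge) hr)
  have e1 := congrArg (fun p => (p.map φ₁).eval x) hq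
  have e2 := congrArg (fun p => (p.map φ₂).eval y) hq
  simp only [Polynomial.map_mul, Polynomial.map_C, Polynomial.map_add, Polynomial.eval_mul,
    Polynomial.eval_add, Polynomial.eval_C, hx, hy, mul_zero, zero_add, map_pow,
    Polynomial.map_pow, Polynomial.eval_pow] at e1 e2
  rw [← e1, ← e2, sign_mul, sign_mul, sign_pos ((even_two_mul k).pow_pos hlc₁),
    sign_pos ((even_two_mul k).pow_pos hlc₂), one_mul, one_mul] at key
  exact key

end RootMatching

end SignTransfer

section SignTransfer

set_option linter.unusedSectionVars false

variable {A : Type*} [CommRing A] {R₁ R₂ : Type*} [Field R₁] [LinearOrder R₁]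
  [IsStrictOrderedRing R₁] [Field R₂] [LinearOrder R₂] [IsStrictOrderedRing R₂]

namespace RootMatching

variable {φ₁ : A →+* R₁} {φ₂ : A →+* R₂} {S s : Set (Polynomial A)} {L : Finset (R₁ × R₂)}
  {B₁ : R₁} {B₂ : R₂}

theorem insert (H : RootMatching φ₁ φ₂ S s L B₁ B₂) {f : Polynomial A}
    (h₁ : f.map φ₁ ≠ 0 → ∀ x, (f.map φ₁).eval x = 0 → ∃ p ∈ L, p.1 = x)
    (h₂ : f.map φ₂ ≠ 0 → ∀ y, (f.map φ₂).eval y = 0 → ∃ p ∈ L, p.2 = y)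
    (h₃ : ∀ x y, SamePosition L x y →
      SignType.sign ((f.map φ₁).eval x) = SignType.sign ((f.map φ₂).eval y)) :
    RootMatching φ₁ φ₂ S (insert f s) L B₁ B₂ where
  mono := H.mono
  top := H.top
  bot := H.bot
  agree := H.agree
  roots₁ g hg := by
    rcases hg with rfl | hg
    · exact h₁
    · exact H.roots₁ g hg
  roots₂ g hg := by
    rcases hg with rfl | hg
    · exact h₂
    · exact H.roots₂ g hg
  sign_eq x y hxy g hg := by
    rcases hg with rfl | hg
    · exact h₃ x y hxy
    · exact H.sign_eq x y hxy g hg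
  bound₁ := H.bound₁
  bound₂ := H.bound₂

theorem sign_eq_of_roots (hR₁ : PolynomialIVT R₁) (hR₂ : PolynomialIVT R₂)
    (H : RootMatching φ₁ φ₂ S s L B₁ B₂) {f : Polynomial A} (hfS : f ∈ S)
    (hd : 0 < f.natDegree) (hf' : f.derivative ∈ s)
    (hlc₁ : φ₁ f.leadingCoeff ≠ 0) (hlc₂ : φ₂ f.leadingCoeff ≠ 0)
    (h₁ : ∀ x, (f.map φ₁).eval x = 0 → ∃ p ∈ L, p.1 = x)
    (h₂ : ∀ y, (f.map φ₂).eval y = 0 → ∃ p ∈ L, p.2 = y) {x : R₁} {y : R₂}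
    (hxy : SamePosition L x y) :
    SignType.sign ((f.map φ₁).eval x) = SignType.sign ((f.map φ₂).eval y) := by
  by_cases hxL : ∃ p ∈ L, p.1 = x
  · obtain ⟨p, hp, rfl⟩ := hxL
    have : p.2 = y := by
      have := hxy p hp
      simp only [lt_self_iff_false, false_iff, not_lt] at this
      exact le_antisymm this.1 this.2
    rw [← this]
    exact H.agree p hp f hfS
  push Not at hxL
  rcases lt_or_ge x (-B₁) with hlt | hge
  · have hy := (hxy _ H.bot).1.1 hlt
    have e := H.agree _ H.bot f hfS
    rwa [← hR₁.sign_eq (f.map φ₁) hlt.le, ← hR₂.sign_eq (f.map φ₂) hy.le] at e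
    · exact fun c _ hc h0 => absurd (H.bound₂ f hfS hlc₂ c h0).1 hc.not_gt
    · exact fun c _ hc h0 => absurd (H.bound₁ f hfS hlc₁ c h0).1 hc.not_gt
  rcases lt_or_ge B₁ x with hlt | hle
  · have hy := (hxy _ H.top).2.1 hlt
    have e := H.agree _ H.top f hfS
    rwa [hR₁.sign_eq (f.map φ₁) hlt.le, hR₂.sign_eq (f.map φ₂) hy.le] at e
    · exact fun c hc _ h0 => absurd (H.bound₂ f hfS hlc₂ c h0).2 hc.not_gt
    · exact fun c hc _ h0 => absurd (H.bound₁ f hfS hlc₁ c h0).2 hc.not_gt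
  obtain ⟨p, hp, q, hq, hpx, hxq, hgap⟩ := exists_neighbors L x hxL
    ⟨_, H.bot, hge.lt_of_ne (hxL _ H.bot)⟩ ⟨_, H.top, hle.lt_of_ne (hxL _ H.top).symm⟩
  have hpy := (hxy p hp).2.1 hpx
  have hyq := (hxy q hq).1.1 hxq
  have hgap₂ : ∀ r ∈ L, r.2 ≤ p.2 ∨ q.2 ≤ r.2 := fun r hr => by
    rw [← not_lt, ← not_lt, ← H.mono p hp r hr, ← H.mono r hr q hq, not_lt, not_lt]
    exact hgap r hr
  by_cases hp0 : (f.map φ₁).eval p.1 = 0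
  · have hq0 : (f.map φ₁).eval q.1 ≠ 0 := fun h0 =>
      H.not_two_roots hR₁ hd hf' hlc₁ (hpx.trans hxq) hgap hp0 h0
    have hq0' : (f.map φ₂).eval q.2 ≠ 0 := mt (eq_zero_iff_of_sign_eq (H.agree q hq f hfS)).2 hq0
    rw [hR₁.sign_eq (f.map φ₁) hxq.le, hR₂.sign_eq (f.map φ₂) hyq.le, H.agree q hq f hfS]
    · intro c hc1 hc2 h0
      obtain ⟨r, hr, rfl⟩ := h₂ c h0
      rcases hgap₂ r hr with h | h
      · exact absurd (hpy.trans_le hc1) h.not_gt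
      · exact hq0' (by rwa [le_antisymm h hc2])
    · intro c hc1 hc2 h0
      obtain ⟨r, hr, rfl⟩ := h₁ c h0
      rcases hgap r hr with h | h
      · exact absurd (hpx.trans_le hc1) h.not_gt
      · exact hq0 (by rwa [le_antisymm h hc2])
  · have hp0' : (f.map φ₂).eval p.2 ≠ 0 := mt (eq_zero_iff_of_sign_eq (H.agree p hp f hfS)).2 hp0
    rw [← hR₁.sign_eq (f.map φ₁) hpx.le, ← hR₂.sign_eq (f.map φ₂) hpy.le, H.agree p hp f hfS]
    · intro c hc1 hc2 h0
      obtain ⟨r, hr, rfl⟩ := h₂ c h0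
      rcases hgap₂ r hr with h | h
      · exact hp0' (by rwa [le_antisymm hc1 h])
      · exact absurd (hc2.trans_lt hyq) h.not_gt
    · intro c hc1 hc2 h0
      obtain ⟨r, hr, rfl⟩ := h₁ c h0
      rcases hgap r hr with h | h
      · exact hp0 (by rwa [le_antisymm hc1 h])
      · exact absurd (hc2.trans_lt hxq) h.not_gt

theorem lt_of_roots (hR₁ : PolynomialIVT R₁) (H : RootMatching φ₁ φ₂ S s L B₁ B₂)
    {f : Polynomial A} (hd : 0 < f.natDegree) (hf' : f.derivative ∈ s)
    (hlc : φ₁ f.leadingCoeff ≠ 0) {x x' : R₁} {y y' : R₂} (hxx : x < x')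
    (hx : (f.map φ₁).eval x = 0) (hx' : (f.map φ₁).eval x' = 0)
    (h : SamePosition L x y) (h' : SamePosition L x' y') : y < y' := by
  by_contra hyy
  refine H.not_two_roots hR₁ hd hf' hlc hxx (fun p hp => ?_) hx hx'
  by_contra hlt
  push Not at hlt
  exact hyy (((h p hp).1.1 hlt.1).trans ((h' p hp).2.1 hlt.2))

open Classical in
theorem exists_insert_nonconstant (hR₁ : PolynomialIVT R₁) (hR₂ : PolynomialIVT R₂)
    (H : RootMatching φ₁ φ₂ S s L B₁ B₂) (hS : IsHormanderClosed S)
    {f : Polynomial A} (hfS : f ∈ S)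
    (hd : 0 < f.natDegree) (hlow : ∀ h ∈ S, h.natDegree < f.natDegree → h ∈ s)
    (hlc₁ : φ₁ f.leadingCoeff ≠ 0) (hlc₂ : φ₂ f.leadingCoeff ≠ 0) :
    ∃ L', RootMatching φ₁ φ₂ S (Insert.insert f s) L' B₁ B₂ := by
  have hf' : f.derivative ∈ s :=
    hlow _ (hS.derivative f hfS hd) (Polynomial.natDegree_derivative_lt hd.ne')
  have hf₁ := Polynomial.map_ne_zero_of_leadingCoeff hlc₁
  have hf₂ := Polynomial.map_ne_zero_of_leadingCoeff hlc₂
  let L' : Finset (R₁ × R₂) := L ∪ ((f.map φ₁).roots.toFinset ×ˢ (f.map φ₂).roots.toFinset).filter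
    fun p => SamePosition L p.1 p.2
  have hmem : ∀ p, p ∈ L' ↔ p ∈ L ∨ ((f.map φ₁).eval p.1 = 0 ∧ (f.map φ₂).eval p.2 = 0) ∧
      SamePosition L p.1 p.2 := by
    intro p
    simp only [L', Finset.mem_union, Finset.mem_filter, Finset.mem_product, Multiset.mem_toFinset,
      Polynomial.mem_roots hf₁, Polynomial.mem_roots hf₂, Polynomial.IsRoot]
  have hsame : ∀ x y, SamePosition L' x y → SamePosition L x y := fun x y h p hp =>
    h p ((hmem p).2 (Or.inl hp))
  have H' : RootMatching φ₁ φ₂ S s L' B₁ B₂ := by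
    refine ⟨?_, (hmem _).2 (Or.inl H.top), (hmem _).2 (Or.inl H.bot), ?_, ?_, ?_, ?_,
      H.bound₁, H.bound₂⟩
    · intro p hp q hq
      rcases (hmem p).1 hp with hp | ⟨⟨hp1, hp2⟩, hp3⟩ <;>
        rcases (hmem q).1 hq with hq | ⟨⟨hq1, hq2⟩, hq3⟩
      · exact H.mono p hp q hq
      · exact (hq3 p hp).2
      · exact (hp3 q hq).1
      · exact ⟨fun h => H.lt_of_roots hR₁ hd hf' hlc₁ h hp1 hq1 hp3 hq3, fun h =>
          H.swap.lt_of_roots hR₂ hd hf' hlc₂ h hp2 hq2 hp3.swap hq3.swap⟩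
    · intro p hp
      rcases (hmem p).1 hp with hp | ⟨⟨hp1, hp2⟩, hp3⟩
      · exact H.agree p hp
      · exact fun h hh => H.agree_of_roots hS hfS hd hlow hlc₁ hlc₂ hp1 hp2 hp3 hh
    · intro g hg h0 x hx
      obtain ⟨p, hp, h⟩ := H.roots₁ g hg h0 x hx
      exact ⟨p, (hmem p).2 (Or.inl hp), h⟩
    · intro g hg h0 x hx
      obtain ⟨p, hp, h⟩ := H.roots₂ g hg h0 x hx
      exact ⟨p, (hmem p).2 (Or.inl hp), h⟩
    · exact fun x y hxy => H.sign_eq x y (hsame x y hxy)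
  have h₁ : ∀ x, (f.map φ₁).eval x = 0 → ∃ p ∈ L', p.1 = x := by
    intro x hx
    obtain ⟨y, hy, hxy⟩ := H.exists_partner hR₁ hR₂ hfS hd hf' hlc₁ hx
    exact ⟨(x, y), (hmem _).2 (Or.inr ⟨⟨hx, hy⟩, hxy⟩), rfl⟩
  have h₂ : ∀ y, (f.map φ₂).eval y = 0 → ∃ p ∈ L', p.2 = y := by
    intro y hy
    obtain ⟨x, hx, hxy⟩ := H.swap.exists_partner hR₂ hR₁ hfS hd hf' hlc₂ hy
    exact ⟨(x, y), (hmem _).2 (Or.inr ⟨⟨hx, hy⟩, hxy.of_swap⟩), rfl⟩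
  exact ⟨L', H'.insert (fun _ => h₁) (fun _ => h₂) fun x y hxy =>
    H'.sign_eq_of_roots hR₁ hR₂ hfS hd hf' hlc₁ hlc₂ h₁ h₂ hxy⟩

end RootMatching

/-- `φ₁` and `φ₂` give the same signs to the constant polynomials in `S`. -/
def AgreeOnConstants (φ₁ : A →+* R₁) (φ₂ : A →+* R₂) (S : Set (Polynomial A)) : Prop :=
  ∀ a, Polynomial.C a ∈ S → SignType.sign (φ₁ a) = SignType.sign (φ₂ a)

theorem AgreeOnConstants.leadingCoeff {φ₁ : A →+* R₁} {φ₂ : A →+* R₂} {S : Set (Polynomial A)}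
    (h : AgreeOnConstants φ₁ φ₂ S) (hS : IsHormanderClosed S) {f : Polynomial A} (hf : f ∈ S) :
    SignType.sign (φ₁ f.leadingCoeff) = SignType.sign (φ₂ f.leadingCoeff) := by
  rcases Nat.eq_zero_or_pos f.natDegree with hd | hd
  · refine h _ ?_
    rwa [Polynomial.leadingCoeff, hd, ← Polynomial.eq_C_of_natDegree_eq_zero hd]
  · exact h _ (hS.lc f hf hd)

theorem Polynomial.map_eraseLead_of_leadingCoeff {φ : A →+* R₁} {f : Polynomial A}
    (h : φ f.leadingCoeff = 0) : f.eraseLead.map φ = f.map φ := by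
  have e := congrArg (Polynomial.map φ) f.eraseLead_add_C_mul_X_pow
  rwa [Polynomial.map_add, Polynomial.map_mul, Polynomial.map_C, h, map_zero, zero_mul,
    add_zero] at e

theorem RootMatching.exists_insert (hR₁ : PolynomialIVT R₁) (hR₂ : PolynomialIVT R₂)
    {φ₁ : A →+* R₁} {φ₂ : A →+* R₂} {S s : Set (Polynomial A)} {L : Finset (R₁ × R₂)}
    {B₁ : R₁} {B₂ : R₂} (H : RootMatching φ₁ φ₂ S s L B₁ B₂) (hS : IsHormanderClosed S)
    (hc : AgreeOnConstants φ₁ φ₂ S) {f : Polynomial A} (hfS : f ∈ S)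
    (hlow : ∀ h ∈ S, h.natDegree < f.natDegree → h ∈ s) :
    ∃ L', RootMatching φ₁ φ₂ S (Insert.insert f s) L' B₁ B₂ := by
  have hlc := hc.leadingCoeff hS hfS
  rcases Nat.eq_zero_or_pos f.natDegree with hd | hd
  · refine ⟨L, H.insert ?_ ?_ ?_⟩
    all_goals
      rw [Polynomial.leadingCoeff, hd] at hlc
      rw [Polynomial.eq_C_of_natDegree_eq_zero hd]
      simp only [Polynomial.map_C, Polynomial.eval_C]
    · exact fun h0 x hx => absurd (by rw [hx, map_zero]) h0
    · exact fun h0 x hx => absurd (by rw [hx, map_zero]) h0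
    · exact fun _ _ _ => hlc
  by_cases h0 : φ₁ f.leadingCoeff = 0
  · have h0' := (eq_zero_iff_of_sign_eq hlc).1 h0
    have hmem := hlow _ (hS.eraseLead f hfS hd) (Polynomial.natDegree_eraseLead_lt_of_pos hd)
    refine ⟨L, H.insert ?_ ?_ ?_⟩
    · rw [← Polynomial.map_eraseLead_of_leadingCoeff h0]
      exact H.roots₁ _ hmem
    · rw [← Polynomial.map_eraseLead_of_leadingCoeff h0']
      exact H.roots₂ _ hmem
    · rw [← Polynomial.map_eraseLead_of_leadingCoeff h0,
        ← Polynomial.map_eraseLead_of_leadingCoeff h0']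
      exact fun x y hxy => H.sign_eq x y hxy _ hmem
  · exact H.exists_insert_nonconstant hR₁ hR₂ hS hfS hd hlow h0
      (mt (eq_zero_iff_of_sign_eq hlc).2 h0)

theorem exists_bound_sign_eval_map (φ : A →+* R₁) {S : Set (Polynomial A)} (hS : S.Finite) :
    ∃ B : R₁, 0 < B ∧ ∀ f ∈ S, φ f.leadingCoeff ≠ 0 →
      (∀ x, B ≤ x → SignType.sign ((f.map φ).eval x) = SignType.sign (φ f.leadingCoeff)) ∧
      (∀ x, x ≤ -B → SignType.sign ((f.map φ).eval x) =
        (-1) ^ f.natDegree * SignType.sign (φ f.leadingCoeff)) := by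
  choose b hb using fun f : Polynomial A => (f.map φ).exists_forall_sign_eval_eq
  choose b' hb' using fun f : Polynomial A => (f.map φ).exists_forall_sign_eval_neg_eq
  obtain ⟨C, hC⟩ := (hS.image b).bddAbove
  obtain ⟨C', hC'⟩ := (hS.image b').bddAbove
  refine ⟨max 1 (max C C'), lt_max_of_lt_left one_pos, fun f hf hlc => ?_⟩
  have h1 : b f ≤ max 1 (max C C') :=
    (hC ⟨f, hf, rfl⟩).trans ((le_max_left _ _).trans (le_max_right _ _))
  have h2 : b' f ≤ max 1 (max C C') :=
    (hC' ⟨f, hf, rfl⟩).trans ((le_max_right _ _).trans (le_max_right _ _))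
  have hl := Polynomial.leadingCoeff_map_of_leadingCoeff_ne_zero φ hlc
  have hn := Polynomial.natDegree_map_of_leadingCoeff_ne_zero φ hlc
  refine ⟨fun x hx => ?_, fun x hx => ?_⟩
  · rw [hb f x (h1.trans hx), hl]
  · rw [hb' f x (hx.trans (neg_le_neg h2)), hl, hn]

theorem exists_rootMatching (hR₁ : PolynomialIVT R₁) (hR₂ : PolynomialIVT R₂)
    {φ₁ : A →+* R₁} {φ₂ : A →+* R₂} {S : Set (Polynomial A)} (hfin : S.Finite)
    (hS : IsHormanderClosed S) (hc : AgreeOnConstants φ₁ φ₂ S) :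
    ∃ L B₁ B₂, RootMatching φ₁ φ₂ S S L B₁ B₂ := by
  classical
  obtain ⟨B₁, hB₁, hB₁'⟩ := exists_bound_sign_eval_map φ₁ hfin
  obtain ⟨B₂, hB₂, hB₂'⟩ := exists_bound_sign_eval_map φ₂ hfin
  have hagree : ∀ f ∈ S,
      SignType.sign ((f.map φ₁).eval B₁) = SignType.sign ((f.map φ₂).eval B₂) ∧
      SignType.sign ((f.map φ₁).eval (-B₁)) = SignType.sign ((f.map φ₂).eval (-B₂)) := by
    intro f hf
    induction hn : f.natDegree using Nat.strong_induction_on generalizing f with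
    | _ n ih =>
      have hlc := hc.leadingCoeff hS hf
      by_cases h0 : φ₁ f.leadingCoeff = 0
      · have h0' := (eq_zero_iff_of_sign_eq hlc).1 h0
        rcases Nat.eq_zero_or_pos f.natDegree with hd | hd
        · rw [Polynomial.leadingCoeff, hd] at h0 h0'
          rw [Polynomial.eq_C_of_natDegree_eq_zero hd]
          simp [h0, h0']
        · rw [← Polynomial.map_eraseLead_of_leadingCoeff h0,
            ← Polynomial.map_eraseLead_of_leadingCoeff h0']
          exact ih _ (hn ▸ Polynomial.natDegree_eraseLead_lt_of_pos hd) _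
            (hS.eraseLead f hf hd) rfl
      · have h0' := mt (eq_zero_iff_of_sign_eq hlc).2 h0
        rw [(hB₁' f hf h0).1 _ le_rfl, (hB₁' f hf h0).2 _ le_rfl, (hB₂' f hf h0').1 _ le_rfl,
          (hB₂' f hf h0').2 _ le_rfl, hlc]
        exact ⟨rfl, rfl⟩
  have hbase : RootMatching φ₁ φ₂ S ∅ {(B₁, B₂), (-B₁, -B₂)} B₁ B₂ := by
    refine ⟨?_, by simp, by simp, ?_, by simp, by simp, by simp, ?_, ?_⟩
    · intro p hp q hq
      have h1 : -B₁ < B₁ := by linarith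
      have h2 : -B₂ < B₂ := by linarith
      simp only [Finset.mem_insert, Finset.mem_singleton] at hp hq
      rcases hp with rfl | rfl <;> rcases hq with rfl | rfl <;>
        simp [hB₁, hB₂, hB₁.not_gt, hB₂.not_gt]
    · intro p hp f hf
      simp only [Finset.mem_insert, Finset.mem_singleton] at hp
      rcases hp with rfl | rfl
      · exact (hagree f hf).1
      · exact (hagree f hf).2
    · intro f hf h0 x hx
      refine ⟨lt_of_not_ge fun h => ?_, lt_of_not_ge fun h => ?_⟩
      · have := (hB₁' f hf h0).2 x h
        rw [hx, sign_zero] at this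
        simp [h0] at this
      · have := (hB₁' f hf h0).1 x h
        rw [hx, sign_zero, eq_comm, sign_eq_zero_iff] at this
        exact h0 this
    · intro f hf h0 x hx
      refine ⟨lt_of_not_ge fun h => ?_, lt_of_not_ge fun h => ?_⟩
      · have := (hB₂' f hf h0).2 x h
        rw [hx, sign_zero] at this
        simp [h0] at this
      · have := (hB₂' f hf h0).1 x h
        rw [hx, sign_zero, eq_comm, sign_eq_zero_iff] at this
        exact h0 this
  have key : ∀ s : Finset (Polynomial A), (s : Set (Polynomial A)) ⊆ S →
      (∀ f ∈ s, ∀ h ∈ S, h.natDegree < f.natDegree → h ∈ s) →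
      ∃ L, RootMatching φ₁ φ₂ S s L B₁ B₂ := by
    intro s
    refine Finset.induction_on_max_value Polynomial.natDegree s ?_ ?_
    · exact fun _ _ => ⟨_, by simpa using hbase⟩
    · intro f s hfs hmax ih hsub hlow
      have hfS : f ∈ S := hsub (by simp)
      obtain ⟨L, HL⟩ := ih (fun g hg => hsub (by simp [Finset.mem_coe.1 hg]))
        (fun g hg h hh hlt => by
        rcases Finset.mem_insert.1 (hlow g (Finset.mem_insert_of_mem hg) h hh hlt) with rfl | h'
        · exact absurd hlt (hmax g hg).not_gt
        · exact h')
      rw [Finset.coe_insert]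
      exact HL.exists_insert hR₁ hR₂ hS hc hfS (fun h hh hlt => by
        rcases Finset.mem_insert.1 (hlow f (Finset.mem_insert_self _ _) h hh hlt) with rfl | h'
        · exact absurd hlt (lt_irrefl _)
        · exact h')
  obtain ⟨L, HL⟩ := key hfin.toFinset (by simp) (fun f _ h hh _ => by simpa using hh)
  exact ⟨L, B₁, B₂, by simpa using HL⟩

theorem RootMatching.exists_samePosition {φ₁ : A →+* R₁} {φ₂ : A →+* R₂}
    {S s : Set (Polynomial A)} {L : Finset (R₁ × R₂)} {B₁ : R₁} {B₂ : R₂}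
    (H : RootMatching φ₁ φ₂ S s L B₁ B₂) (x : R₁) : ∃ y, SamePosition L x y := by
  classical
  by_cases hxL : ∃ p ∈ L, p.1 = x
  · obtain ⟨p, hp, rfl⟩ := hxL
    exact ⟨p.2, H.samePosition hp⟩
  push Not at hxL
  obtain ⟨y, hy1, hy2⟩ := Order.exists_between_finsets ((L.filter fun p => p.1 < x).image Prod.snd)
    ((L.filter fun p => x < p.1).image Prod.snd) (by
      intro a ha b hb
      simp only [Finset.mem_image, Finset.mem_filter] at ha hb
      obtain ⟨p, ⟨hp, hpx⟩, rfl⟩ := ha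
      obtain ⟨q, ⟨hq, hqx⟩, rfl⟩ := hb
      exact (H.mono p hp q hq).1 (hpx.trans hqx))
  refine ⟨y, fun p hp => ?_⟩
  rcases (hxL p hp).lt_or_gt with h | h
  · have := hy1 p.2 (Finset.mem_image_of_mem _ (Finset.mem_filter.2 ⟨hp, h⟩))
    exact ⟨iff_of_false h.not_gt this.not_gt, iff_of_true h this⟩
  · have := hy2 p.2 (Finset.mem_image_of_mem _ (Finset.mem_filter.2 ⟨hp, h⟩))
    exact ⟨iff_of_true h this, iff_of_false h.not_gt this.not_gt⟩

end SignTransfer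

section Transfer

universe u v w

/-- **Elimination of one variable**: the sign patterns realised by finitely many polynomials in one
variable are controlled by the signs of finitely many coefficients. -/
theorem exists_finite_sign_control {A : Type u} [CommRing A] {S : Set (Polynomial A)}
    (hS : S.Finite) : ∃ T : Set A, T.Finite ∧
      ∀ (R₁ : Type v) (R₂ : Type w) [Field R₁] [LinearOrder R₁] [IsStrictOrderedRing R₁]
        [Field R₂] [LinearOrder R₂] [IsStrictOrderedRing R₂] (φ₁ : A →+* R₁) (φ₂ : A →+* R₂),
        PolynomialIVT R₁ → PolynomialIVT R₂ →
        (∀ a ∈ T, SignType.sign (φ₁ a) = SignType.sign (φ₂ a)) → ∀ x, ∃ y, ∀ f ∈ S,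
          SignType.sign (f.eval₂ φ₁ x) = SignType.sign (f.eval₂ φ₂ y) := by
  have hfin := HormanderClosure.finite hS
  refine ⟨Polynomial.C ⁻¹' {f | HormanderClosure S f},
    hfin.preimage Polynomial.C_injective.injOn, ?_⟩
  intro R₁ R₂ _ _ _ _ _ _ φ₁ φ₂ hR₁ hR₂ hT x
  obtain ⟨L, B₁, B₂, H⟩ := exists_rootMatching hR₁ hR₂ hfin
    (HormanderClosure.isHormanderClosed S) (φ₁ := φ₁) (φ₂ := φ₂) (fun a ha => hT a ha)
  obtain ⟨y, hy⟩ := H.exists_samePosition x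
  refine ⟨y, fun f hf => ?_⟩
  rw [← Polynomial.eval_map, ← Polynomial.eval_map]
  exact H.sign_eq x y hy f (HormanderClosure.base hf)

theorem MvPolynomial.eval₂_finSuccEquiv {B R : Type*} [CommRing B] [CommRing R] {n : ℕ}
    (β : B →+* R) (z : Fin (n + 1) → R) (f : MvPolynomial (Fin (n + 1)) B) :
    (finSuccEquiv B n f).eval₂ (eval₂Hom β (Fin.tail z)) (z 0) = f.eval₂ β z := by
  induction f using MvPolynomial.induction_on with
  | C a => simp [finSuccEquiv_apply]
  | add p q hp hq => simp [hp, hq, Polynomial.eval₂_add]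
  | mul_X p i hp =>
    rw [map_mul, Polynomial.eval₂_mul, hp, MvPolynomial.eval₂_mul, eval₂_X]
    congr 1
    refine Fin.cases ?_ (fun j => ?_) i
    · simp [finSuccEquiv_X_zero]
    · simp [finSuccEquiv_X_succ, Fin.tail]

/-- **Tarski transfer** for finite systems of sign conditions. -/
theorem exists_ringHom_sign_eq {B : Type u} [CommRing B] {R₁ : Type v} {R₂ : Type w}
    [Field R₁] [LinearOrder R₁] [IsStrictOrderedRing R₁]
    [Field R₂] [LinearOrder R₂] [IsStrictOrderedRing R₂]
    (hR₁ : PolynomialIVT R₁) (hR₂ : PolynomialIVT R₂) (β₁ : B →+* R₁) (β₂ : B →+* R₂)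
    (hβ : ∀ b, SignType.sign (β₁ b) = SignType.sign (β₂ b)) (n : ℕ) (x : Fin n → R₁)
    {S : Set (MvPolynomial (Fin n) B)} (hS : S.Finite) :
    ∃ y : Fin n → R₂, ∀ f ∈ S,
      SignType.sign (f.eval₂ β₁ x) = SignType.sign (f.eval₂ β₂ y) := by
  induction n with
  | zero =>
    refine ⟨Fin.elim0, fun f _ => ?_⟩
    obtain ⟨b, rfl⟩ := MvPolynomial.C_surjective (Fin 0) f
    simpa using hβ b
  | succ n ih =>
    obtain ⟨T, hT, hctl⟩ := exists_finite_sign_control.{u, v, w}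
      (hS.image (MvPolynomial.finSuccEquiv B n))
    obtain ⟨y, hy⟩ := ih (Fin.tail x) hT
    obtain ⟨y₀, hy₀⟩ := hctl R₁ R₂ (eval₂Hom β₁ (Fin.tail x)) (eval₂Hom β₂ y) hR₁ hR₂
      (by simpa using hy) (x 0)
    refine ⟨Fin.cons y₀ y, fun f hf => ?_⟩
    have h := hy₀ _ ⟨f, hf, rfl⟩
    have e := MvPolynomial.eval₂_finSuccEquiv β₂ (Fin.cons y₀ y) f
    rw [Fin.tail_cons, Fin.cons_zero] at e
    rwa [MvPolynomial.eval₂_finSuccEquiv β₁ x f, e] at h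

end Transfer

section PrimeCone

variable {A : Type*} [CommRing A]

/-- The subsemiring `P + P x`, for a subsemiring `P` containing `x ^ 2`. -/
def Subsemiring.adjoinElem (P : Subsemiring A) (x : A) (hx : x * x ∈ P) : Subsemiring A where
  carrier := {y | ∃ a ∈ P, ∃ b ∈ P, y = a + x * b}
  zero_mem' := ⟨0, P.zero_mem, 0, P.zero_mem, by ring⟩
  one_mem' := ⟨1, P.one_mem, 0, P.zero_mem, by ring⟩
  add_mem' := by
    rintro _ _ ⟨a, ha, b, hb, rfl⟩ ⟨c, hc, d, hd, rfl⟩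
    exact ⟨a + c, P.add_mem ha hc, b + d, P.add_mem hb hd, by ring⟩
  mul_mem' := by
    rintro _ _ ⟨a, ha, b, hb, rfl⟩ ⟨c, hc, d, hd, rfl⟩
    exact ⟨a * c + x * x * (b * d), P.add_mem (P.mul_mem ha hc) (P.mul_mem hx (P.mul_mem hb hd)),
      a * d + b * c, P.add_mem (P.mul_mem ha hd) (P.mul_mem hb hc), by ring⟩

theorem Subsemiring.le_adjoinElem (P : Subsemiring A) (x : A) (hx : x * x ∈ P) :
    P ≤ P.adjoinElem x hx :=
  fun a ha => ⟨a, ha, 0, P.zero_mem, by ring⟩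

theorem Subsemiring.self_mem_adjoinElem (P : Subsemiring A) (x : A) (hx : x * x ∈ P) :
    x ∈ P.adjoinElem x hx :=
  ⟨0, P.zero_mem, 1, P.one_mem, by ring⟩

/-- A prime cone (a point of the real spectrum). -/
structure Subsemiring.IsPrimeCone (P : Subsemiring A) : Prop where
  mul_self_mem : ∀ a, a * a ∈ P
  neg_one_notMem : -1 ∉ P
  mem_or_mem : ∀ x y, -(x * y) ∈ P → x ∈ P ∨ y ∈ P

theorem Subsemiring.IsPrimeCone.mem_or_neg_mem {P : Subsemiring A} (hP : P.IsPrimeCone) (x : A) :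
    x ∈ P ∨ -x ∈ P :=
  hP.mem_or_mem x (-x) (by simpa using hP.mul_self_mem x)

/-- Every proper preordering is contained in a prime cone. -/
theorem Subsemiring.exists_isPrimeCone (T : Subsemiring A) (hsq : ∀ a, a * a ∈ T)
    (hT : -1 ∉ T) : ∃ P : Subsemiring A, T ≤ P ∧ P.IsPrimeCone := by
  obtain ⟨P, hTP, hmax⟩ := zorn_le_nonempty₀ {P : Subsemiring A | -1 ∉ P} (by
    intro c hc hchain y hy
    refine ⟨sSup c, ?_, fun z hz => le_sSup hz⟩
    intro h
    obtain ⟨Q, hQ, hmem⟩ := (Subsemiring.mem_sSup_of_directedOn ⟨y, hy⟩ hchain.directedOn).1 h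
    exact hc hQ hmem) T hT
  have hsqP : ∀ a, a * a ∈ P := fun a => hTP (hsq a)
  refine ⟨P, hTP, hsqP, hmax.prop, fun x y hxy => ?_⟩
  by_contra hcon
  push Not at hcon
  have key : ∀ z, z ∉ P → -1 ∈ P.adjoinElem z (hsqP z) := by
    intro z hz
    by_contra h
    exact hz (hmax.le_of_ge (y := P.adjoinElem z (hsqP z)) h (P.le_adjoinElem z _)
      (P.self_mem_adjoinElem z _))
  obtain ⟨a, ha, b, hb, h1⟩ := key x hcon.1
  obtain ⟨c, hc, d, hd, h2⟩ := key y hcon.2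
  refine hmax.prop (show -1 ∈ P from ?_)
  have : (-1 : A) = a + c + a * c + -(x * y) * (b * d) := by
    linear_combination (1 + c) * h1 - (x * b) * h2
  rw [this]
  exact P.add_mem (P.add_mem (P.add_mem ha hc) (P.mul_mem ha hc)) (P.mul_mem hxy (P.mul_mem hb hd))

/-- The support of a prime cone. -/
def Subsemiring.IsPrimeCone.support {P : Subsemiring A} (hP : P.IsPrimeCone) : Ideal A where
  carrier := {x | x ∈ P ∧ -x ∈ P}
  zero_mem' := by simp [P.zero_mem]
  add_mem' := by
    rintro a b ⟨ha, ha'⟩ ⟨hb, hb'⟩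
    exact ⟨P.add_mem ha hb, by rw [neg_add]; exact P.add_mem ha' hb'⟩
  smul_mem' := by
    rintro c x ⟨hx, hx'⟩
    rcases hP.mem_or_neg_mem c with hc | hc
    · exact ⟨P.mul_mem hc hx, by simpa using P.mul_mem hc hx'⟩
    · exact ⟨by simpa using P.mul_mem hc hx', by simpa using P.mul_mem hc hx⟩

theorem Subsemiring.IsPrimeCone.isPrime_support {P : Subsemiring A} (hP : P.IsPrimeCone) :
    hP.support.IsPrime := by
  refine ⟨fun h => hP.neg_one_notMem ?_, fun {x y} hxy => ?_⟩
  · have : (1 : A) ∈ hP.support := h ▸ Submodule.mem_top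
    exact this.2
  · by_contra hcon
    have hcase : ∀ z, z ∉ hP.support → z ∉ P ∨ -z ∉ P := fun z hz => by
      by_contra h
      push Not at h
      exact hz h
    push Not at hcon
    have h1 := hxy.1
    have h2 := hxy.2
    rcases hcase x hcon.1 with hx | hx <;> rcases hcase y hcon.2 with hy | hy
    · exact (hP.mem_or_mem x y h2).elim hx hy
    · exact (hP.mem_or_mem x (-y) (by simpa using h1)).elim hx hy
    · exact (hP.mem_or_mem (-x) y (by simpa using h1)).elim hx hy
    · exact (hP.mem_or_mem (-x) (-y) (by simpa using h2)).elim hx hy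

end PrimeCone

section FieldCone

variable {Ω : Type*} [Field Ω]

/-- `C` is the set of nonnegative elements for an ordering of a subfield of `Ω`. -/
structure IsFieldCone (C : Set Ω) : Prop where
  zero : 0 ∈ C
  one : 1 ∈ C
  add : ∀ x ∈ C, ∀ y ∈ C, x + y ∈ C
  mul : ∀ x ∈ C, ∀ y ∈ C, x * y ∈ C
  inv : ∀ x ∈ C, x⁻¹ ∈ C
  eq_zero : ∀ x ∈ C, -x ∈ C → x = 0
  total : ∀ x ∈ C, ∀ y ∈ C, x - y ∈ C ∨ y - x ∈ C

namespace IsFieldCone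

variable {C : Set Ω}

theorem exists_maximal (hC : IsFieldCone C) :
    ∃ M, C ⊆ M ∧ Maximal (IsFieldCone (Ω := Ω)) M := by
  refine zorn_subset_nonempty {C : Set Ω | IsFieldCone C} ?_ C hC
  intro c hc hchain hne
  refine ⟨⋃₀ c, ?_, fun s hs => Set.subset_sUnion_of_mem hs⟩
  obtain ⟨D, hD⟩ := hne
  have two : ∀ x ∈ ⋃₀ c, ∀ y ∈ ⋃₀ c, ∃ E ∈ c, x ∈ E ∧ y ∈ E := by
    rintro x ⟨E, hE, hx⟩ y ⟨F, hF, hy⟩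
    rcases hchain.total hE hF with h | h
    · exact ⟨F, hF, h hx, hy⟩
    · exact ⟨E, hE, hx, h hy⟩
  refine ⟨⟨D, hD, (hc hD).zero⟩, ⟨D, hD, (hc hD).one⟩, ?_, ?_, ?_, ?_, ?_⟩
  · intro x hx y hy
    obtain ⟨E, hE, hx, hy⟩ := two x hx y hy
    exact ⟨E, hE, (hc hE).add x hx y hy⟩
  · intro x hx y hy
    obtain ⟨E, hE, hx, hy⟩ := two x hx y hy
    exact ⟨E, hE, (hc hE).mul x hx y hy⟩
  · rintro x ⟨E, hE, hx⟩
    exact ⟨E, hE, (hc hE).inv x hx⟩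
  · intro x hx y
    obtain ⟨E, hE, hx, hy⟩ := two x hx _ y
    exact (hc hE).eq_zero x hx hy
  · intro x hx y hy
    obtain ⟨E, hE, hx, hy⟩ := two x hx y hy
    exact ((hc hE).total x hx y hy).imp (fun h => ⟨E, hE, h⟩) (fun h => ⟨E, hE, h⟩)

/-- The subfield ordered by a field cone. -/
def subfield (hC : IsFieldCone C) : Subfield Ω where
  carrier := {x | x ∈ C ∨ -x ∈ C}
  zero_mem' := Or.inl hC.zero
  one_mem' := Or.inl hC.one
  neg_mem' := by
    rintro x (h | h)
    · exact Or.inr (by simpa using h)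
    · exact Or.inl h
  add_mem' := by
    rintro x y (hx | hx) (hy | hy)
    · exact Or.inl (hC.add x hx y hy)
    · exact (hC.total x hx _ hy).imp (fun h => by simpa using h)
        (fun h => by rwa [neg_add_rev, ← sub_eq_add_neg])
    · exact (hC.total y hy _ hx).imp (fun h => by rwa [sub_neg_eq_add, add_comm] at h)
        (fun h => by rwa [neg_add, ← sub_eq_add_neg])
    · exact Or.inr (by rw [neg_add]; exact hC.add _ hx _ hy)
  mul_mem' := by
    rintro x y (hx | hx) (hy | hy)
    · exact Or.inl (hC.mul x hx y hy)
    · exact Or.inr (by simpa using hC.mul x hx _ hy)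
    · exact Or.inr (by simpa using hC.mul _ hx _ hy)
    · exact Or.inl (by simpa using hC.mul _ hx _ hy)
  inv_mem' := by
    rintro x (hx | hx)
    · exact Or.inl (hC.inv x hx)
    · exact Or.inr (by simpa [inv_neg] using hC.inv _ hx)

theorem mem_subfield (hC : IsFieldCone C) {x : Ω} : x ∈ hC.subfield ↔ x ∈ C ∨ -x ∈ C :=
  Iff.rfl

/-- The order on the subfield defined by a field cone. -/
noncomputable abbrev linearOrder (hC : IsFieldCone C) : LinearOrder hC.subfield where
  le x y := (y - x : Ω) ∈ C
  le_refl x := by simpa using hC.zero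
  le_trans x y z hxy hyz := by simpa using hC.add _ hxy _ hyz
  le_antisymm x y hxy hyx := by
    have := hC.eq_zero _ hyx (by simpa using hxy)
    exact Subtype.ext (sub_eq_zero.1 this)
  le_total x y := by
    have := (y - x).2
    rw [mem_subfield] at this
    simpa using this
  toDecidableLE := Classical.decRel _

theorem isStrictOrderedRing (hC : IsFieldCone C) :
    let := hC.linearOrder
    IsStrictOrderedRing hC.subfield := by
  let := hC.linearOrder
  have hle : ∀ x y : hC.subfield, x ≤ y ↔ (y - x : Ω) ∈ C := fun _ _ => Iff.rfl
  have : IsOrderedAddMonoid hC.subfield := ⟨fun x y h z => by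
    rw [hle] at h ⊢
    simpa using h, fun x y h z => by
    rw [hle] at h ⊢
    simpa using h⟩
  have : ZeroLEOneClass hC.subfield := ⟨by
    rw [hle]
    simpa using hC.one⟩
  refine IsStrictOrderedRing.of_mul_pos fun x y hx hy => ?_
  refine lt_of_le_of_ne ?_ (mul_ne_zero hx.ne' hy.ne').symm
  have h1 := hx.le
  have h2 := hy.le
  rw [hle] at h1 h2 ⊢
  simpa using hC.mul _ h1 _ h2

end IsFieldCone

end FieldCone

section RealClosed

universe u

open Polynomial in
theorem exists_isPrimeCone_adjoinRoot {L : Type*} [Field L] [LinearOrder L]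
    [IsStrictOrderedRing L] {p : L[X]} (hp : Irreducible p) {a b : L} (ha : p.eval a < 0)
    (hb : 0 < p.eval b)
    (ih : ∀ h : L[X], h.natDegree < p.natDegree → h.eval a < 0 → 0 < h.eval b →
      ∃ c, h.eval c = 0) :
    ∃ P : Subsemiring (AdjoinRoot p), P.IsPrimeCone ∧ ∀ c, 0 ≤ c → AdjoinRoot.of p c ∈ P := by
  let M : Submonoid (AdjoinRoot p) :=
    { carrier := {x | ∃ c, 0 ≤ c ∧ ∃ y, x = AdjoinRoot.of p c * (y * y)}
      one_mem' := ⟨1, zero_le_one, 1, by simp⟩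
      mul_mem' := by
        rintro _ _ ⟨c, hc, y, rfl⟩ ⟨d, hd, z, rfl⟩
        exact ⟨c * d, mul_nonneg hc hd, y * z, by rw [map_mul]; ring⟩ }
  have hM : ∀ x, x ∈ M.subsemiringClosure ↔ x ∈ AddSubmonoid.closure (M : Set (AdjoinRoot p)) :=
    fun x => by rw [← SetLike.mem_coe, Submonoid.subsemiringClosure_coe, SetLike.mem_coe]
  have hMle : ∀ x ∈ M, x ∈ M.subsemiringClosure := fun x hx =>
    (hM x).2 (AddSubmonoid.subset_closure hx)
  have hd0 : 0 < p.natDegree := hp.natDegree_pos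
  have hrep : ∀ x ∈ M.subsemiringClosure, ∃ G : L[X], G.natDegree + 2 ≤ 2 * p.natDegree ∧
      AdjoinRoot.mk p G = x ∧ ∀ z, 0 ≤ G.eval z := by
    intro x hx
    rw [hM] at hx
    induction hx using AddSubmonoid.closure_induction with
    | mem x hx =>
      obtain ⟨c, hc, y, rfl⟩ := hx
      obtain ⟨g, rfl⟩ := AdjoinRoot.mk_surjective y
      refine ⟨Polynomial.C c * ((g % p) * (g % p)), ?_, ?_, fun z => ?_⟩
      · have h1 : (g % p).natDegree < p.natDegree :=
          Polynomial.natDegree_mod_lt g hd0.ne'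
        have h2 := (Polynomial.natDegree_C_mul_le c ((g % p) * (g % p))).trans
          Polynomial.natDegree_mul_le
        omega
      · have : AdjoinRoot.mk p (g % p) = AdjoinRoot.mk p g := by
          conv_rhs => rw [← EuclideanDomain.div_add_mod g p]
          simp
        rw [map_mul, map_mul, this, AdjoinRoot.mk_C]
      · simpa using mul_nonneg hc (mul_self_nonneg _)
    | zero => exact ⟨0, by simp; omega, by simp, by simp⟩
    | add x y _ _ hx hy =>
      obtain ⟨G, hG1, hG2, hG3⟩ := hx
      obtain ⟨H, hH1, hH2, hH3⟩ := hy
      refine ⟨G + H, ?_, by rw [map_add, hG2, hH2], fun z => ?_⟩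
      · have := Polynomial.natDegree_add_le G H
        omega
      · simpa using add_nonneg (hG3 z) (hH3 z)
  obtain ⟨P, hP, hP'⟩ := M.subsemiringClosure.exists_isPrimeCone
    (fun x => hMle _ ⟨1, zero_le_one, x, by simp⟩) (fun hneg => by
      obtain ⟨G, hG1, hG2, hG3⟩ := hrep _ hneg
      have hdvd : p ∣ G + 1 := by
        rw [← AdjoinRoot.mk_eq_zero, map_add, hG2, map_one, neg_add_cancel]
      obtain ⟨h, hh⟩ := hdvd
      have hev : ∀ z, 0 < p.eval z * h.eval z := fun z => by
        rw [← Polynomial.eval_mul, ← hh]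
        simpa using add_pos_of_nonneg_of_pos (hG3 z) one_pos
      have h0 : h ≠ 0 := by
        rintro rfl
        simpa using hev 0
      have hdeg := Polynomial.natDegree_mul hp.ne_zero h0
      have hdeg' : (G + 1).natDegree ≤ G.natDegree :=
        (Polynomial.natDegree_add_le _ _).trans (by simp)
      rw [hh] at hdeg'
      obtain ⟨c, hc⟩ := ih h (by omega) (neg_of_mul_pos_right (hev a) ha.le)
        ((pos_iff_pos_of_mul_pos (hev b)).1 hb)
      simpa [hc] using hev c)
  exact ⟨P, hP', fun c hc => hP (hMle _ ⟨c, hc, 1, by simp⟩)⟩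

theorem IsFieldCone.polynomialIVT {Ω : Type*} [Field Ω] [IsAlgClosed Ω] {C : Set Ω}
    (hC : IsFieldCone C) (hmax : Maximal (IsFieldCone (Ω := Ω)) C) :
    @PolynomialIVT hC.subfield _ hC.linearOrder := by
  let := hC.linearOrder
  have := hC.isStrictOrderedRing
  intro p a b hab ha hb
  induction hn : p.natDegree using Nat.strong_induction_on generalizing p with
  | _ n ih =>
    subst hn
    have hp0 : p ≠ 0 := by
      rintro rfl
      simp at ha
    have hpu : ¬ IsUnit p := fun hu => by
      obtain ⟨c, -, rfl⟩ := Polynomial.isUnit_iff.1 hu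
      rw [Polynomial.eval_C] at ha hb
      exact lt_asymm ha hb
    by_cases hirr : Irreducible p
    · obtain ⟨P, hP, hPC⟩ := exists_isPrimeCone_adjoinRoot hirr ha hb fun h hdeg h1 h2 => by
        obtain ⟨c, -, -, hc⟩ := ih _ hdeg h h1 h2 rfl
        exact ⟨c, hc⟩
      have := Fact.mk hirr
      obtain ⟨θ, hθ⟩ := IsAlgClosed.exists_aeval_eq_zero Ω p
        (Polynomial.degree_pos_of_irreducible hirr).ne'
      let ι : AdjoinRoot p →+* Ω := AdjoinRoot.lift (algebraMap hC.subfield Ω) θ hθ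
      have hD : IsFieldCone (ι '' (P : Set (AdjoinRoot p))) := by
        refine ⟨⟨0, P.zero_mem, map_zero _⟩, ⟨1, P.one_mem, map_one _⟩, ?_, ?_, ?_, ?_, ?_⟩
        · rintro _ ⟨x, hx, rfl⟩ _ ⟨y, hy, rfl⟩
          exact ⟨x + y, P.add_mem hx hy, map_add _ _ _⟩
        · rintro _ ⟨x, hx, rfl⟩ _ ⟨y, hy, rfl⟩
          exact ⟨x * y, P.mul_mem hx hy, map_mul _ _ _⟩
        · rintro _ ⟨x, hx, rfl⟩
          refine ⟨x⁻¹, ?_, map_inv₀ _ _⟩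
          have : x⁻¹ = x * (x⁻¹ * x⁻¹) := by
            rcases eq_or_ne x 0 with rfl | h
            · simp
            · field_simp
          rw [this]
          exact P.mul_mem hx (hP.mul_self_mem _)
        · rintro _ ⟨x, hx, rfl⟩ ⟨y, hy, hyx⟩
          rw [← map_neg] at hyx
          rw [ι.injective hyx] at hy
          by_contra h0
          have hx0 : x ≠ 0 := fun h => h0 (by rw [h, map_zero])
          refine hP.neg_one_notMem ?_
          have : (-1 : AdjoinRoot p) = x * -x * (x⁻¹ * x⁻¹) := by field_simp
          rw [this]
          exact P.mul_mem (P.mul_mem hx hy) (hP.mul_self_mem _)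
        · rintro _ ⟨x, hx, rfl⟩ _ ⟨y, hy, rfl⟩
          refine (hP.mem_or_neg_mem (x - y)).imp (fun h => ⟨_, h, map_sub _ _ _⟩)
            (fun h => ⟨_, h, by rw [neg_sub, map_sub]⟩)
      have hCD : C ⊆ ι '' (P : Set (AdjoinRoot p)) := fun c hc =>
        ⟨AdjoinRoot.of p ⟨c, Or.inl hc⟩, hPC _ (show ((⟨c, _⟩ : hC.subfield) - 0 : Ω) ∈ C by
          simpa using hc), AdjoinRoot.lift_of _⟩
      have hDC := hmax.le_of_ge hD hCD
      have hθC : θ ∈ hC.subfield := by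
        have hroot : ι (AdjoinRoot.root p) = θ := AdjoinRoot.lift_root _
        rcases hP.mem_or_neg_mem (AdjoinRoot.root p) with h | h
        · exact Or.inl (hDC ⟨_, h, hroot⟩)
        · exact Or.inr (hDC ⟨_, h, by rw [map_neg, hroot]⟩)
      have hr : p.eval ⟨θ, hθC⟩ = 0 := by
        apply (algebraMap hC.subfield Ω).injective
        rw [map_zero, ← hθ, ← Polynomial.aeval_algebraMap_apply_eq_algebraMap_eval]
        rfl
      obtain ⟨q, hq⟩ := Polynomial.dvd_iff_isRoot.2 hr
      rcases hirr.isUnit_or_isUnit hq with h | h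
      · exact absurd h (Polynomial.not_isUnit_X_sub_C _)
      · obtain ⟨u, -, rfl⟩ := Polynomial.isUnit_iff.1 h
        rw [hq, Polynomial.eval_mul, Polynomial.eval_sub, Polynomial.eval_X, Polynomial.eval_C,
          Polynomial.eval_C] at ha hb
        refine ⟨⟨θ, hθC⟩, ?_, ?_, hr⟩ <;> by_contra hcon <;> push Not at hcon
        · nlinarith
        · nlinarith
    · rw [irreducible_iff] at hirr
      push Not at hirr
      obtain ⟨u, v, huv, hu, hv⟩ := hirr hpu
      have hu0 : u ≠ 0 := by rintro rfl; exact hp0 (by simpa using huv)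
      have hv0 : v ≠ 0 := by rintro rfl; exact hp0 (by simpa using huv)
      have hdeg := Polynomial.natDegree_mul hu0 hv0
      rw [← huv] at hdeg
      have hpos : ∀ w : Polynomial hC.subfield, ¬ IsUnit w → w ≠ 0 → 0 < w.natDegree :=
        fun w hw hw0 => Nat.pos_of_ne_zero fun h => hw (Polynomial.isUnit_iff_degree_eq_zero.2
          (by rw [Polynomial.degree_eq_natDegree hw0, h]; rfl))
      have hupos := hpos u hu hu0
      have hvpos := hpos v hv hv0
      rw [huv, Polynomial.eval_mul] at ha hb
      have hex : ∀ w : Polynomial hC.subfield, w.natDegree < p.natDegree →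
          w.eval a * w.eval b < 0 → ∃ c, a < c ∧ c < b ∧ w.eval c = 0 := by
        intro w hw hwab
        rcases mul_neg_iff.1 hwab with ⟨h1, h2⟩ | ⟨h1, h2⟩
        · obtain ⟨c, h1, h2, h3⟩ := ih _ hw (-w) (by simpa using h1) (by simpa using h2)
            (Polynomial.natDegree_neg w)
          exact ⟨c, h1, h2, by simpa using h3⟩
        · exact ih _ hw w h1 h2 rfl
      have hneg : (u.eval a * u.eval b) * (v.eval a * v.eval b) < 0 := by
        have := mul_neg_of_neg_of_pos ha hb
        linarith [this, mul_mul_mul_comm (u.eval a) (v.eval a) (u.eval b) (v.eval b)]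
      rcases mul_neg_iff.1 hneg with ⟨-, h⟩ | ⟨h, -⟩
      · obtain ⟨c, h1, h2, h3⟩ := hex v (by omega) h
        exact ⟨c, h1, h2, by rw [huv, Polynomial.eval_mul, h3, mul_zero]⟩
      · obtain ⟨c, h1, h2, h3⟩ := hex u (by omega) h
        exact ⟨c, h1, h2, by rw [huv, Polynomial.eval_mul, h3, zero_mul]⟩

/-- Every prime cone is nonnegative under some homomorphism to an ordered field with the
intermediate value property for polynomials. -/
theorem Subsemiring.IsPrimeCone.exists_ringHom {A : Type u} [CommRing A] {P : Subsemiring A}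
    (hP : P.IsPrimeCone) :
    ∃ (R : Type u) (_ : Field R) (_ : LinearOrder R) (_ : IsStrictOrderedRing R) (φ : A →+* R),
      PolynomialIVT R ∧ ∀ a ∈ P, 0 ≤ φ a := by
  have := hP.isPrime_support
  let Ω := AlgebraicClosure (FractionRing (A ⧸ hP.support))
  let ψ : A →+* Ω := (algebraMap (FractionRing (A ⧸ hP.support)) Ω).comp
    ((algebraMap (A ⧸ hP.support) (FractionRing (A ⧸ hP.support))).comp
      (Ideal.Quotient.mk hP.support))
  have hψ : ∀ a, ψ a = 0 ↔ a ∈ hP.support := fun a => by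
    rw [← Ideal.Quotient.eq_zero_iff_mem]
    simp [ψ]
  have hC : IsFieldCone {x : Ω | ∃ a ∈ P, ∃ b ∈ P, ψ b ≠ 0 ∧ x = ψ a / ψ b} := by
    have h1 : ψ 1 ≠ 0 := by simp
    refine ⟨⟨0, P.zero_mem, 1, P.one_mem, h1, by simp⟩, ⟨1, P.one_mem, 1, P.one_mem, h1, by simp⟩,
      ?_, ?_, ?_, ?_, ?_⟩
    · rintro _ ⟨a, ha, b, hb, hb0, rfl⟩ _ ⟨c, hc, d, hd, hd0, rfl⟩
      refine ⟨a * d + b * c, P.add_mem (P.mul_mem ha hd) (P.mul_mem hb hc), b * d, P.mul_mem hb hd,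
        by rw [map_mul]; exact mul_ne_zero hb0 hd0, ?_⟩
      rw [div_add_div _ _ hb0 hd0]
      simp
    · rintro _ ⟨a, ha, b, hb, hb0, rfl⟩ _ ⟨c, hc, d, hd, hd0, rfl⟩
      refine ⟨a * c, P.mul_mem ha hc, b * d, P.mul_mem hb hd,
        by rw [map_mul]; exact mul_ne_zero hb0 hd0, ?_⟩
      rw [div_mul_div_comm]
      simp
    · rintro _ ⟨a, ha, b, hb, hb0, rfl⟩
      by_cases ha0 : ψ a = 0
      · exact ⟨0, P.zero_mem, 1, P.one_mem, h1, by simp [ha0]⟩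
      · exact ⟨b, hb, a, ha, ha0, by simp⟩
    · rintro _ ⟨a, ha, b, hb, hb0, rfl⟩ ⟨c, hc, d, hd, hd0, h⟩
      rw [← neg_div, div_eq_div_iff hb0 hd0] at h
      have h2 : a * d + c * b ∈ hP.support := by
        rw [← hψ, map_add, map_mul, map_mul, ← h]
        ring
      have h3 : a * d ∈ hP.support := by
        refine ⟨P.mul_mem ha hd, ?_⟩
        have := P.add_mem h2.2 (P.mul_mem hc hb)
        simpa using this
      rcases hP.isPrime_support.mem_or_mem h3 with h | h
      · rw [(hψ a).2 h, zero_div]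
      · exact absurd ((hψ d).2 h) hd0
    · rintro _ ⟨a, ha, b, hb, hb0, rfl⟩ _ ⟨c, hc, d, hd, hd0, rfl⟩
      have hbd : ψ (b * d) ≠ 0 := by rw [map_mul]; exact mul_ne_zero hb0 hd0
      rcases hP.mem_or_neg_mem (a * d - b * c) with h | h
      · exact Or.inl ⟨_, h, b * d, P.mul_mem hb hd, hbd, by
          rw [div_sub_div _ _ hb0 hd0]; simp⟩
      · exact Or.inr ⟨_, h, b * d, P.mul_mem hb hd, hbd, by
          rw [div_sub_div _ _ hd0 hb0]; simp [mul_comm]⟩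
  obtain ⟨M, hCM, hM⟩ := hC.exists_maximal
  have hMem : ∀ a ∈ P, ψ a ∈ M := fun a ha =>
    hCM ⟨a, ha, 1, P.one_mem, by simp, by simp⟩
  let φ : A →+* hM.prop.subfield := ψ.codRestrict hM.prop.subfield fun a => by
    rcases hP.mem_or_neg_mem a with h | h
    · exact Or.inl (hMem a h)
    · exact Or.inr (by simpa using hMem _ h)
  refine ⟨hM.prop.subfield, inferInstance, hM.prop.linearOrder, hM.prop.isStrictOrderedRing, φ,
    hM.prop.polynomialIVT hM, fun a ha => ?_⟩
  show ((φ a) - (0 : hM.prop.subfield) : Ω) ∈ M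
  have : ((φ a : hM.prop.subfield) : Ω) = ψ a := rfl
  simpa [this] using hMem a ha

end RealClosed

section Certificates

theorem Real.polynomialIVT : PolynomialIVT ℝ := by
  intro p a b hab ha hb
  obtain ⟨c, hc, h0⟩ := intermediate_value_Icc hab.le p.continuous.continuousOn
    (show (0 : ℝ) ∈ Set.Icc (p.eval a) (p.eval b) from ⟨ha.le, hb.le⟩)
  refine ⟨c, hc.1.lt_of_ne ?_, hc.2.lt_of_ne ?_, h0⟩
  · rintro rfl
    exact ha.ne h0
  · rintro rfl
    exact hb.ne' h0

theorem sign_ringHom_real {R : Type*} [Field R] [LinearOrder R] [IsStrictOrderedRing R]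
    (β : ℝ →+* R) (r : ℝ) : SignType.sign (β r) = SignType.sign r := by
  have hpos : ∀ s : ℝ, 0 < s → 0 < β s := fun s hs => by
    rw [← Real.mul_self_sqrt hs.le, map_mul]
    exact mul_self_pos.2 ((map_ne_zero β).2 (Real.sqrt_pos.2 hs).ne')
  rcases lt_trichotomy r 0 with h | rfl | h
  · have := hpos (-r) (by linarith)
    rw [map_neg] at this
    rw [sign_neg h, sign_neg (by linarith)]
  · rw [map_zero, sign_zero, sign_zero]
  · rw [sign_pos h, sign_pos (hpos r h)]

variable {n : ℕ}

/-- The preordering generated by one polynomial. -/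
noncomputable def preorderingOf (p : MvPolynomial (Fin n) ℝ) :
    Subsemiring (MvPolynomial (Fin n) ℝ) :=
  (Subsemiring.sumSq _).adjoinElem p (Subsemiring.mem_sumSq.2 (IsSumSq.mul_self p))

theorem mul_self_mem_preorderingOf (p a : MvPolynomial (Fin n) ℝ) : a * a ∈ preorderingOf p :=
  Subsemiring.le_adjoinElem _ _ _ (Subsemiring.mem_sumSq.2 (IsSumSq.mul_self a))

theorem self_mem_preorderingOf (p : MvPolynomial (Fin n) ℝ) : p ∈ preorderingOf p :=
  Subsemiring.self_mem_adjoinElem _ _ _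

/-- A **Positivstellensatz** with denominators. -/
theorem exists_mul_eq_one_add_of_pos {p q : MvPolynomial (Fin n) ℝ}
    (h : ∀ x : Fin n → ℝ, 0 ≤ eval x p → 0 < eval x q) :
    ∃ t ∈ preorderingOf p, ∃ t' ∈ preorderingOf p, q * t = 1 + t' := by
  let T := (preorderingOf p).adjoinElem (-q) (by simpa using mul_self_mem_preorderingOf p q)
  by_cases hT : -1 ∈ T
  · obtain ⟨a, ha, b, hb, hab⟩ := hT
    exact ⟨b, hb, a, ha, by linear_combination hab⟩
  have hle : preorderingOf p ≤ T := Subsemiring.le_adjoinElem _ _ _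
  obtain ⟨P, hTP, hP⟩ := T.exists_isPrimeCone (fun a => hle (mul_self_mem_preorderingOf p a)) hT
  obtain ⟨R, _, _, _, φ, hR, hφ⟩ := hP.exists_ringHom
  obtain ⟨y, hy⟩ := exists_ringHom_sign_eq hR Real.polynomialIVT (φ.comp C) (RingHom.id ℝ)
    (sign_ringHom_real (φ.comp C)) n (fun i => φ (X i)) (Set.toFinite {p, q})
  have hev : ∀ f : MvPolynomial (Fin n) ℝ, f.eval₂ (φ.comp C) (fun i => φ (X i)) = φ f :=
    fun f => by
      have := MvPolynomial.eval₂_comp_left φ C X f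
      rw [eval₂_eta] at this
      exact this.symm
  have hsp := hy p (by simp)
  have hsq := hy q (by simp)
  rw [hev] at hsp hsq
  have h1 : 0 ≤ φ p := hφ p (hTP (hle (self_mem_preorderingOf p)))
  have h2 : φ q ≤ 0 := by
    have := hφ (-q) (hTP (Subsemiring.self_mem_adjoinElem _ _ _))
    rw [map_neg] at this
    linarith
  have h3 : 0 ≤ eval y p := by
    rw [← sign_nonneg_iff] at h1 ⊢
    rwa [hsp] at h1
  have h4 : eval y q ≤ 0 := by
    rw [← sign_nonpos_iff] at h2 ⊢
    rwa [hsq] at h2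
  exact absurd (h y h3) h4.not_gt

variable {T : Subsemiring (MvPolynomial (Fin n) ℝ)}

theorem C_mem_of_nonneg (hsq : ∀ a, a * a ∈ T) {r : ℝ} (hr : 0 ≤ r) : C r ∈ T := by
  rw [← Real.mul_self_sqrt hr, C_mul]
  exact hsq _

/-- A preordering containing `N - ∑ X i ^ 2` is Archimedean. -/
theorem exists_C_sub_mem (hsq : ∀ a, a * a ∈ T) {N : ℝ} (hN : C N - ∑ i, X i * X i ∈ T)
    (a : MvPolynomial (Fin n) ℝ) : ∃ r : ℝ, C r - a ∈ T := by
  have hC : ∀ {r : ℝ}, 0 ≤ r → C r ∈ T := fun hr => C_mem_of_nonneg hsq hr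
  suffices h : ∃ r : ℝ, 0 ≤ r ∧ C r - a ∈ T ∧ C r + a ∈ T from
    ⟨h.choose, h.choose_spec.2.1⟩
  have hadd : ∀ a b : MvPolynomial (Fin n) ℝ, (∃ r : ℝ, 0 ≤ r ∧ C r - a ∈ T ∧ C r + a ∈ T) →
      (∃ r : ℝ, 0 ≤ r ∧ C r - b ∈ T ∧ C r + b ∈ T) →
      ∃ r : ℝ, 0 ≤ r ∧ C r - (a + b) ∈ T ∧ C r + (a + b) ∈ T := by
    rintro a b ⟨r, hr, h1, h2⟩ ⟨s, hs, h3, h4⟩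
    refine ⟨r + s, add_nonneg hr hs, ?_, ?_⟩
    · convert T.add_mem h1 h3 using 1
      rw [C_add]
      ring
    · convert T.add_mem h2 h4 using 1
      rw [C_add]
      ring
  induction a using MvPolynomial.induction_on with
  | C c =>
    refine ⟨|c|, abs_nonneg c, ?_, ?_⟩
    · rw [← C_sub]
      exact hC (sub_nonneg.2 (le_abs_self c))
    · rw [← C_add]
      exact hC (by linarith [neg_abs_le c])
  | add a b ha hb => exact hadd a b ha hb
  | mul_X a i ha =>
    have hX : ∃ r : ℝ, 0 ≤ r ∧ C r - (X i : MvPolynomial (Fin n) ℝ) ∈ T ∧ C r + X i ∈ T := by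
      have hXi : C N - X i * X i ∈ T := by
        have := T.add_mem hN (T.sum_mem (t := Finset.univ.erase i) fun j _ => hsq (X j))
        rwa [← Finset.add_sum_erase _ _ (Finset.mem_univ i), sub_add, add_sub_cancel_right] at this
      have h4 : (C (1 / 4) : MvPolynomial (Fin n) ℝ) = C (1 / 2) * C (1 / 2) := by
        rw [← C_mul]
        norm_num
      have h2 : (C (1 / 2) : MvPolynomial (Fin n) ℝ) + C (1 / 2) = 1 := by
        rw [← C_add]
        norm_num
      have hle : ∀ {r s : ℝ} {b : MvPolynomial (Fin n) ℝ}, r ≤ s → C r + b ∈ T → C s + b ∈ T := by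
        intro r s b hrs h
        convert T.add_mem (hC (sub_nonneg.2 hrs)) h using 1
        rw [C_sub]
        ring
      refine ⟨max 0 (N + 1 / 4), le_max_left _ _, ?_, ?_⟩
      · rw [sub_eq_add_neg]
        refine hle (le_max_right _ _) ?_
        convert T.add_mem hXi (hsq (X i - C (1 / 2))) using 1
        rw [C_add, h4]
        linear_combination (X i : MvPolynomial (Fin n) ℝ) * h2
      · refine hle (le_max_right _ _) ?_
        convert T.add_mem hXi (hsq (X i + C (1 / 2))) using 1
        rw [C_add, h4]
        linear_combination -(X i : MvPolynomial (Fin n) ℝ) * h2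
    obtain ⟨r, hr, h1, h2⟩ := ha
    obtain ⟨s, hs, h3, h4⟩ := hX
    have hhalves : (C (1 / 2) : MvPolynomial (Fin n) ℝ) + C (1 / 2) = 1 := by
      rw [← C_add]
      norm_num
    have hhalf : (C (1 / 2) : MvPolynomial (Fin n) ℝ) ∈ T := hC (by norm_num)
    refine ⟨r * s, mul_nonneg hr hs, ?_, ?_⟩
    · convert T.mul_mem hhalf (T.add_mem (T.mul_mem h1 h4) (T.mul_mem h2 h3)) using 1
      rw [C_mul]
      linear_combination (-(C r * C s - a * X i)) * hhalves
    · convert T.mul_mem hhalf (T.add_mem (T.mul_mem h1 h3) (T.mul_mem h2 h4)) using 1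
      rw [C_mul]
      linear_combination (-(C r * C s + a * X i)) * hhalves

/-- **Wörmann's trick**: an identity `q t = 1 + t'` with `q = N - ∑ X i ^ 2` makes a preordering
Archimedean. -/
theorem exists_C_sub_sum_mem (hsq : ∀ a, a * a ∈ T) {N : ℝ} (hN : 0 ≤ N)
    {q t t' w : MvPolynomial (Fin n) ℝ} (hw : w = ∑ i, X i * X i) (hq : q = C N - w) (ht : t ∈ T)
    (ht' : t' ∈ T) (hqt : q * t = 1 + t') :
    ∃ M : ℝ, C M - ∑ i, X i * X i ∈ T := by
  have hqq : q * q ∈ T := hsq q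
  obtain ⟨k, u, hu, v, hv, huv⟩ := exists_C_sub_mem (T := T.adjoinElem q hqq)
    (fun a => T.le_adjoinElem q hqq (hsq a))
    (by rw [← hw, ← hq]; exact T.self_mem_adjoinElem q hqq) t'
  have h1t : 1 + t' ∈ T := T.add_mem T.one_mem ht'
  have hc : C (k + k * k / 4) - t' ∈ T := by
    have h4 : (C (k + k * k / 4) : MvPolynomial (Fin n) ℝ) = C k + C (k / 2) * C (k / 2) := by
      rw [← C_mul, ← C_add]
      congr 1
      ring
    have h2 : (C k : MvPolynomial (Fin n) ℝ) = C (k / 2) + C (k / 2) := by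
      rw [← C_add]
      congr 1
      ring
    have e : C (k + k * k / 4) - t' =
        (1 + t') * u + q * q * (t * v) + (C (k / 2) - t') * (C (k / 2) - t') := by
      rw [h4]
      linear_combination (1 + t') * huv - t' * h2 - q * v * hqt
    rw [e]
    exact T.add_mem (T.add_mem (T.mul_mem h1t hu) (T.mul_mem hqq (T.mul_mem ht hv)))
      (hsq (C (k / 2) - t'))
  have hw_mem : w ∈ T := hw ▸ T.sum_mem fun i _ => hsq _
  have e : C (N + N * (k + k * k / 4)) - w =
      q * q * t + t' * w + C N * (C (k + k * k / 4) - t') := by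
    rw [C_add, C_mul]
    linear_combination (-q) * hqt - (1 + t') * hq
  refine ⟨N + N * (k + k * k / 4), ?_⟩
  rw [← hw, e]
  exact T.add_mem (T.add_mem (T.mul_mem hqq ht) (T.mul_mem ht' hw_mem))
    (T.mul_mem (C_mem_of_nonneg hsq hN) hc)

/-- If `{p ≥ 0}` is bounded, then the preordering generated by `p` is Archimedean. -/
theorem exists_C_sub_mem_preorderingOf {p : MvPolynomial (Fin n) ℝ}
    (hp : IsCompact {x : Fin n → ℝ | 0 ≤ eval x p}) (a : MvPolynomial (Fin n) ℝ) :
    ∃ r : ℝ, C r - a ∈ preorderingOf p := by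
  have hsq := mul_self_mem_preorderingOf p
  obtain ⟨w, hw⟩ : ∃ w : MvPolynomial (Fin n) ℝ, w = ∑ i, X i * X i := ⟨_, rfl⟩
  obtain ⟨N, hN⟩ := hp.bddAbove_image (f := fun x => eval x w)
    (MvPolynomial.continuous_eval _).continuousOn
  have hpos : ∀ x : Fin n → ℝ, 0 ≤ eval x p → 0 < eval x (C (|N| + 1) - w) := fun x hx => by
    have h1 : eval x w ≤ N := hN (Set.mem_image_of_mem _ hx)
    have h2 := le_abs_self N
    rw [map_sub, eval_C]
    linarith
  obtain ⟨t, ht, t', ht', hqt⟩ := exists_mul_eq_one_add_of_pos hpos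
  obtain ⟨M, hM⟩ := exists_C_sub_sum_mem hsq (N := |N| + 1) (by positivity) hw rfl ht ht' hqt
  exact exists_C_sub_mem hsq hM a

/-- Strictly positive polynomials on `{p ≥ 0}` belong to the preordering generated by `p` when it
is Archimedean. -/
theorem mem_preorderingOf_of_pos {p f : MvPolynomial (Fin n) ℝ}
    (hp : ∀ a, ∃ r : ℝ, C r - a ∈ preorderingOf p)
    (hf : ∀ x : Fin n → ℝ, 0 ≤ eval x p → 0 < eval x f) : f ∈ preorderingOf p := by
  have hsq := mul_self_mem_preorderingOf p
  obtain ⟨s, hs, t, ht, hst⟩ := exists_mul_eq_one_add_of_pos hf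
  set T := preorderingOf p
  obtain ⟨l₀, hl₀⟩ := hp s
  obtain ⟨k, hk⟩ := hp (-f)
  have hl : C (|l₀| + 1) - s ∈ T := by
    have := T.add_mem hl₀ (C_mem_of_nonneg hsq (show 0 ≤ |l₀| + 1 - l₀ by
      linarith [le_abs_self l₀]))
    rwa [C_sub, sub_add_sub_cancel'] at this
  set l : ℝ := |l₀| + 1 with hldef
  have hlpos : 0 < l := by positivity
  have step : ∀ r : ℝ, 0 ≤ r → C r + f ∈ T → C (r - l⁻¹) + f ∈ T := by
    intro r hr h
    have hinv : (C l⁻¹ : MvPolynomial (Fin n) ℝ) * C l = 1 := by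
      rw [← C_mul, inv_mul_cancel₀ hlpos.ne', C_1]
    convert T.mul_mem (C_mem_of_nonneg hsq (inv_nonneg.2 hlpos.le)) (T.add_mem (T.add_mem
      (T.mul_mem hl h) (T.mul_mem (C_mem_of_nonneg hsq hr) hs)) ht) using 1
    rw [C_sub]
    linear_combination (-(C r + f)) * hinv + C l⁻¹ * hst
  by_contra hcon
  have hall : ∀ m : ℕ, C (k - m * l⁻¹) + f ∈ T := by
    intro m
    induction m with
    | zero => simpa using hk
    | succ m ih =>
      have hnn : 0 ≤ k - m * l⁻¹ := by
        by_contra hneg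
        push Not at hneg
        refine hcon ?_
        have := T.add_mem (C_mem_of_nonneg hsq (neg_nonneg.2 hneg.le)) ih
        rwa [← add_assoc, ← C_add, neg_add_cancel, C_0, zero_add] at this
      have := step _ hnn ih
      rwa [sub_sub, ← add_one_mul, ← Nat.cast_succ] at this
  obtain ⟨m, hm⟩ := exists_nat_gt (k * l)
  refine hcon ?_
  have hneg : k - m * l⁻¹ ≤ 0 := by
    rw [sub_nonpos, ← div_eq_mul_inv, le_div_iff₀ hlpos]
    exact hm.le
  have := T.add_mem (C_mem_of_nonneg hsq (neg_nonneg.2 hneg)) (hall m)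
  rwa [← add_assoc, ← C_add, neg_add_cancel, C_0, zero_add] at this

end Certificates

section Putinar

theorem isSumOfSquares_of_isSumSq {n : ℕ} {s : MvPolynomial (Fin n) ℝ} (hs : IsSumSq s) :
    IsSumOfSquares s := by
  induction hs with
  | zero => exact ⟨0, Fin.elim0, by simp⟩
  | sq_add a _ ih =>
    obtain ⟨r, h, rfl⟩ := ih
    exact ⟨r + 1, Fin.cons a h, by simp [Fin.sum_univ_succ, sq]⟩

theorem IsSumOfSquares.isSumSq {n : ℕ} {s : MvPolynomial (Fin n) ℝ} (hs : IsSumOfSquares s) :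
    IsSumSq s := by
  obtain ⟨r, h, rfl⟩ := hs
  exact IsSumSq.sum_sq _ _

theorem MemQuadraticModule.of_mem_preorderingOf {n m : ℕ} {g : Fin m → MvPolynomial (Fin n) ℝ}
    {p f : MvPolynomial (Fin n) ℝ} (hp : MemQuadraticModule g p) (hf : f ∈ preorderingOf p) :
    MemQuadraticModule g f := by
  obtain ⟨s, hs, t, ht, rfl⟩ := hf
  obtain ⟨τ₀, τ, hτ₀, hτ, rfl⟩ := hp
  rw [Subsemiring.mem_sumSq] at hs ht
  refine ⟨s + τ₀ * t, fun j => τ j * t, isSumOfSquares_of_isSumSq (hs.add (hτ₀.isSumSq.mul ht)),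
    fun j => isSumOfSquares_of_isSumSq ((hτ j).isSumSq.mul ht), ?_⟩
  rw [add_mul, Finset.sum_mul, add_assoc]
  congr 2
  exact Finset.sum_congr rfl fun j _ => by ring

theorem MemQuadraticModule.add_sum {n m : ℕ} {g : Fin m → MvPolynomial (Fin n) ℝ}
    {f : MvPolynomial (Fin n) ℝ} (hf : MemQuadraticModule g f)
    {τ : Fin m → MvPolynomial (Fin n) ℝ} (hτ : ∀ j, IsSumSq (τ j)) :
    MemQuadraticModule g (f + ∑ j, τ j * g j) := by
  obtain ⟨σ₀, σ, hσ₀, hσ, rfl⟩ := hf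
  refine ⟨σ₀, fun j => σ j + τ j, hσ₀,
    fun j => isSumOfSquares_of_isSumSq ((hσ j).isSumSq.add (hτ j)), ?_⟩
  rw [add_assoc, ← Finset.sum_add_distrib]
  simp only [add_mul]

theorem mul_one_sub_pow_le {γ : ℝ} (hγ : |γ| ≤ 1) {k : ℕ} (hk : 0 < k) :
    γ * (1 - γ) ^ (2 * k) ≤ 1 / (2 * k) - max 0 (-γ) := by
  have hk' : (0 : ℝ) < 2 * k := by positivity
  rw [abs_le] at hγ
  rcases le_or_gt 0 γ with h0 | h0
  · rw [max_eq_left (by linarith), sub_zero, le_div_iff₀ hk']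
    have h1 : 1 + ((2 * k : ℕ) : ℝ) * γ ≤ (1 + γ) ^ (2 * k) :=
      one_add_mul_le_pow (by linarith) _
    push_cast at h1
    have h2 : (0 : ℝ) ≤ (1 - γ) ^ (2 * k) := (even_two_mul k).pow_nonneg _
    have h3 : (1 - γ) ^ (2 * k) * (1 + γ) ^ (2 * k) ≤ 1 := by
      rw [← mul_pow]
      exact pow_le_one₀ (by nlinarith) (by nlinarith)
    nlinarith [mul_le_mul_of_nonneg_left h1 h2]
  · rw [max_eq_right (by linarith)]
    have h1 : (1 : ℝ) ≤ (1 - γ) ^ (2 * k) := one_le_pow₀ (by linarith)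
    have h2 : (0 : ℝ) < 1 / (2 * k) := by positivity
    nlinarith

/-- On a compact set, a function positive where all `γ j` are nonnegative remains positive after
subtracting suitable nonnegative multiples of the `γ j`. -/
theorem exists_sub_sum_pos {X : Type*} [TopologicalSpace X] {B : Set X} (hB : IsCompact B) {m : ℕ}
    {f : X → ℝ} (hf : Continuous f) {γ : Fin m → X → ℝ} (hγ : ∀ j, Continuous (γ j))
    (hbd : ∀ j, ∀ x ∈ B, |γ j x| ≤ 1) (hpos : ∀ x ∈ B, (∀ j, 0 ≤ γ j x) → 0 < f x) :
    ∃ c : ℝ, 0 ≤ c ∧ ∃ k : ℕ, ∀ x ∈ B, 0 < f x - ∑ j, c * (γ j x * (1 - γ j x) ^ (2 * k)) := by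
  let G : X → ℝ := fun x => ∑ j, max 0 (-γ j x)
  have hG : Continuous G := continuous_finsetSum _ fun j _ => continuous_const.max (hγ j).neg
  have hG0 : ∀ x, 0 ≤ G x := fun x => Finset.sum_nonneg fun j _ => le_max_left _ _
  have hB' : IsCompact (B ∩ {x | f x ≤ 0}) :=
    hB.inter_right (isClosed_le hf continuous_const)
  obtain ⟨δ, hδ, hδG⟩ := hB'.exists_forall_le' hG.continuousOn (a := 0) (by
    rintro x ⟨hx, hfx⟩
    refine (hG0 x).lt_of_ne fun h => ?_
    refine (hpos x hx fun j => ?_).not_ge hfx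
    have := (Finset.sum_eq_zero_iff_of_nonneg fun j _ => le_max_left _ _).1 h.symm j
      (Finset.mem_univ j)
    have := le_max_right 0 (-γ j x)
    linarith)
  obtain ⟨b, hb⟩ := hB.bddBelow_image hf.continuousOn
  let c : ℝ := (|b| + 1) / δ
  have hc : 0 ≤ c := by positivity
  obtain ⟨ε, hε, hεf⟩ := hB.exists_forall_le' (f := fun x => f x + c * G x)
    (hf.add (continuous_const.mul hG)).continuousOn (a := 0) (by
      intro x hx
      rcases lt_or_ge 0 (f x) with h | h
      · exact add_pos_of_pos_of_nonneg h (mul_nonneg hc (hG0 x))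
      · have h1 : c * δ ≤ c * G x := mul_le_mul_of_nonneg_left (hδG x ⟨hx, h⟩) hc
        have h2 : c * δ = |b| + 1 := div_mul_cancel₀ _ hδ.ne'
        have h3 : b ≤ f x := hb ⟨x, hx, rfl⟩
        linarith [neg_abs_le b])
  obtain ⟨k, hk⟩ := exists_nat_gt (c * m / ε)
  have hk0 : 0 < k := by
    have : (0 : ℝ) ≤ c * m / ε := by positivity
    exact_mod_cast this.trans_lt hk
  refine ⟨c, hc, k, fun x hx => ?_⟩
  have hsum : ∑ j, c * (γ j x * (1 - γ j x) ^ (2 * k)) ≤ c * (m * (1 / (2 * k)) - G x) := by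
    rw [← Finset.mul_sum]
    refine mul_le_mul_of_nonneg_left ?_ hc
    calc ∑ j, γ j x * (1 - γ j x) ^ (2 * k)
        ≤ ∑ j : Fin m, (1 / (2 * k) - max 0 (-γ j x)) :=
          Finset.sum_le_sum fun j _ => mul_one_sub_pow_le (hbd j x hx) hk0
      _ = m * (1 / (2 * k)) - G x := by simp [G, Finset.sum_sub_distrib]
  have h1 := hεf x hx
  have h2 : c * (m * (1 / (2 * k))) < ε := by
    have hk' : (0 : ℝ) < k := by exact_mod_cast hk0
    rw [div_lt_iff₀ hε] at hk
    rw [← mul_assoc, mul_one_div, div_lt_iff₀ (by positivity)]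
    nlinarith
  nlinarith

theorem exists_pos_forall_abs_eval_le {n m : ℕ} (g : Fin m → MvPolynomial (Fin n) ℝ)
    {B : Set (Fin n → ℝ)} (hB : IsCompact B) :
    ∃ D : ℝ, 0 < D ∧ ∀ j, ∀ x ∈ B, |eval x (g j)| ≤ D := by
  obtain ⟨D, hD⟩ := hB.bddAbove_image (f := fun x => ∑ j, |eval x (g j)|)
    (continuous_finsetSum _ fun j _ => (MvPolynomial.continuous_eval _).abs).continuousOn
  refine ⟨|D| + 1, by positivity, fun j x hx => ?_⟩
  have h1 : ∑ j, |eval x (g j)| ≤ D := hD (Set.mem_image_of_mem _ hx)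
  have h2 := Finset.single_le_sum (f := fun j => |eval x (g j)|) (fun j _ => abs_nonneg _)
    (Finset.mem_univ j)
  linarith [le_abs_self D]

end Putinar

/-- (Putinar's Positivstellensatz.) If the quadratic module
`Q(g)` is Archimedean, `K = {x : g_j(x) ≥ 0 ∀j}` is nonempty, and `f > 0` on
`K`, then `f ∈ Q(g)`. -/
theorem putinar_positivstellensatz {n m : ℕ}
    (f : MvPolynomial (Fin n) ℝ) (g : Fin m → MvPolynomial (Fin n) ℝ)
    (K : Set (Fin n → ℝ)) (hK : K = {x | ∀ j, 0 ≤ eval x (g j)})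
    (hKne : K.Nonempty)
    (hArch : ∃ p : MvPolynomial (Fin n) ℝ, MemQuadraticModule g p ∧
      IsCompact {x : Fin n → ℝ | 0 ≤ eval x p})
    (hf : ∀ x ∈ K, 0 < eval x f) :
    MemQuadraticModule g f := by
  subst hK
  obtain ⟨p, hp, hcomp⟩ := hArch
  obtain ⟨D, hD, hgD⟩ := exists_pos_forall_abs_eval_le g hcomp
  obtain ⟨c, hc, k, hck⟩ := exists_sub_sum_pos hcomp (f := fun x => eval x f)
    (MvPolynomial.continuous_eval f) (γ := fun j x => D⁻¹ * eval x (g j))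
    (fun j => continuous_const.mul (MvPolynomial.continuous_eval (g j)))
    (fun j x hx => by
      rw [abs_mul, abs_of_pos (inv_pos.2 hD), inv_mul_le_one₀ hD]
      exact hgD j x hx)
    (fun x _ hx => hf x fun j => by simpa [hD, hD.le] using mul_nonneg hD.le (hx j))
  let τ : Fin m → MvPolynomial (Fin n) ℝ := fun j =>
    C (c * D⁻¹) * (1 - C D⁻¹ * g j) ^ (2 * k)
  have hτ : ∀ j, IsSumSq (τ j) := fun j => by
    refine IsSumSq.mul ?_ ((even_two_mul k).isSquare_pow _).isSumSq
    rw [← Real.mul_self_sqrt (mul_nonneg hc (inv_pos.2 hD).le), C_mul]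
    exact IsSumSq.mul_self _
  have hF : f - ∑ j, τ j * g j ∈ preorderingOf p :=
    mem_preorderingOf_of_pos (exists_C_sub_mem_preorderingOf hcomp) fun x hx => by
      have := hck x hx
      have e : ∑ j, c * (D⁻¹ * eval x (g j) * (1 - D⁻¹ * eval x (g j)) ^ (2 * k)) =
          eval x (∑ j, τ j * g j) := by
        rw [map_sum]
        refine Finset.sum_congr rfl fun j _ => ?_
        simp only [τ, map_mul, map_pow, map_sub, map_one, eval_C]
        ring
      rwa [e, ← map_sub] at this
  have := (hp.of_mem_preorderingOf hF).add_sum hτ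
  rwa [sub_add_cancel] at this
end
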